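/- arXiv:1502.02717 — 9 statements merged into one kernel-verified Lean document; each statement's English description precedes it below -/
import Mathlib

section
/- Let p be a prime and t ≥ 1. If n ≥ 2 and there exists a BH(n, p^t), then p divides n. -/
/-- A Butson Hadamard matrix `BH(n,k)`: an `n × n` complex matrix whose entries
are `k`-th roots of unity with `H * Hᴴ = n • 1`. -/
def IsBH (n k : ℕ) (H : Matrix (Fin n) (Fin n) ℂ) : Prop :=
  (∀ i j, H i j ^ k = 1) ∧ H * H.conjTranspose = (n : ℂ) • 1

theorem prime_dvd_sum_pow_prime_pow_sub {R ι : Type*} [CommRing R] {p : ℕ} (hp : p.Prime)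
    (t : ℕ) (s : Finset ι) (f : ι → R) :
    (p : R) ∣ (∑ i ∈ s, f i) ^ p ^ t - ∑ i ∈ s, f i ^ p ^ t := by
  classical
  induction s using Finset.induction_on with
  | empty => simp [hp.ne_zero]
  | insert a s ha ih =>
    rw [Finset.sum_insert ha, Finset.sum_insert ha]
    obtain ⟨r, hr⟩ := exists_add_pow_prime_pow_eq hp (f a) (∑ i ∈ s, f i) t
    obtain ⟨c, hc⟩ := ih
    exact ⟨f a * (∑ i ∈ s, f i) * r + c, by linear_combination hr + hc⟩

theorem int_dvd_of_isIntegral_mul_eq {K : Type*} [Field K] [CharZero K] {a b : ℤ} {x : K}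
    (ha : a ≠ 0) (hx : IsIntegral ℤ x) (h : (b : K) = a * x) : a ∣ b := by
  have haK : (a : K) ≠ 0 := by exact_mod_cast ha
  have hxq : algebraMap ℚ K ((b : ℚ) / a) = x := by
    simp only [map_div₀, map_intCast]
    rw [h, mul_div_cancel_left₀ _ haK]
  rw [← hxq, isIntegral_algebraMap_iff (algebraMap ℚ K).injective] at hx
  obtain ⟨m, hm⟩ := IsIntegrallyClosed.isIntegral_iff.mp hx
  refine ⟨m, ?_⟩
  have haQ : (a : ℚ) ≠ 0 := by exact_mod_cast ha
  rw [eq_div_iff haQ, eq_intCast] at hm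
  rw [mul_comm]
  exact_mod_cast hm.symm

/-- A vanishing sum of `p ^ t`-th roots of unity in characteristic zero has a number of terms
divisible by `p`. -/
theorem prime_dvd_card_of_sum_eq_zero_of_pow_eq_one {K ι : Type*} [Field K] [CharZero K]
    {p t : ℕ} (hp : p.Prime) (s : Finset ι) (z : ι → K) (hz : ∀ i, z i ^ p ^ t = 1)
    (hsum : ∑ i ∈ s, z i = 0) : p ∣ s.card := by
  have hpt : 0 < p ^ t := pow_pos hp.pos t
  let w : ι → integralClosure ℤ K := fun i =>
    ⟨z i, IsIntegral.of_pow hpt (by rw [hz i]; exact isIntegral_one)⟩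
  have hw : ∀ i, w i ^ p ^ t = 1 := fun i => Subtype.ext (hz i)
  have hwsum : ∑ i ∈ s, w i = 0 := Subtype.ext (by simpa [w] using hsum)
  obtain ⟨r, hr⟩ := prime_dvd_sum_pow_prime_pow_sub hp t s w
  simp only [hw, hwsum, zero_pow hpt.ne', Finset.sum_const, nsmul_eq_mul, mul_one] at hr
  have hrK : (0 : K) - s.card = p * (r : K) := by exact_mod_cast congrArg Subtype.val hr
  have hdvd : (p : ℤ) ∣ -(s.card : ℤ) :=
    int_dvd_of_isIntegral_mul_eq (x := (r : K)) (by exact_mod_cast hp.ne_zero) r.2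
      (by push_cast; linear_combination hrK)
  exact_mod_cast (dvd_neg.mp hdvd)

/-- If a `BH(n, p^t)` exists with `p` prime, `t ≥ 1` and `n ≥ 2`, then `p ∣ n`. -/
theorem prime_dvd_order_of_BH_prime_power_phase
    (p t n : ℕ) (hp : p.Prime) (ht : 1 ≤ t) (hn : 2 ≤ n)
    (H : Matrix (Fin n) (Fin n) ℂ) (hH : IsBH n (p ^ t) H) :
    p ∣ n := by
  obtain ⟨hroot, horth⟩ := hH
  let i : Fin n := ⟨0, by omega⟩
  let j : Fin n := ⟨1, by omega⟩
  have hij : i ≠ j := by simp [i, j]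
  have hsum : ∑ k, H i k * star (H j k) = 0 := by
    simpa [Matrix.mul_apply, hij] using congrFun (congrFun horth i) j
  have hpow : ∀ k, (H i k * star (H j k)) ^ p ^ t = 1 := fun k => by
    rw [mul_pow, ← star_pow, hroot, hroot, star_one, mul_one]
  simpa using prime_dvd_card_of_sum_eq_zero_of_pow_eq_one hp Finset.univ _ hpow hsum
end

section
/- Let p be a prime dividing n, and let H be an n×n complex matrix all of whose entries are p-th roots of unity. Then H·Hᴴ = n·I (i.e., H is a BH(n,p)) if and only if for every pair of distinct row indices i ≠ j and every p-th root of unity u ∈ ℂ, the number of columns c with H(i,c)·conj(H(j,c)) = u equals n/p (i.e., H is a GH(n, C_p)). -/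
/-- A finite sum of `p`-th roots of unity, `p` prime, vanishes iff every `p`-th root of unity
occurs equally often among its terms. -/
theorem sum_rootsOfUnity_eq_zero_iff {K ι : Type*} [Field K] [CharZero K] [DecidableEq K]
    [Fintype ι] {p : ℕ} (hp : p.Prime) {ζ : K} (hζ : IsPrimitiveRoot ζ p) (x : ι → K)
    (hx : ∀ c, x c ^ p = 1) :
    ∑ c, x c = 0 ↔
      ∀ u : K, u ^ p = 1 → p * (Finset.univ.filter fun c => x c = u).card = Fintype.card ι := by
  have : NeZero p := ⟨hp.ne_zero⟩
  have hinj : Function.Injective fun k : Fin p => ζ ^ (k : ℕ) := fun a b hab =>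
    Fin.ext (hζ.pow_inj a.2 b.2 hab)
  have hex : ∀ u : K, u ^ p = 1 → ∃ k : Fin p, ζ ^ (k : ℕ) = u := fun u hu => by
    obtain ⟨i, hi, h⟩ := hζ.eq_pow_of_pow_eq_one hu
    exact ⟨⟨i, hi⟩, h⟩
  choose e he using fun c => hex (x c) (hx c)
  have hfiber (k : Fin p) : (Finset.univ.filter fun c => x c = ζ ^ (k : ℕ)) =
      Finset.univ.filter fun c => e c = k := by
    ext c
    simp only [Finset.mem_filter, Finset.mem_univ, true_and, ← he c]
    exact hinj.eq_iff
  set α : Fin p → ℤ := fun k => (Finset.univ.filter fun c => e c = k).card with hα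
  have hsum : ∑ c, x c = ∑ k, (α k : K) * ζ ^ (k : ℕ) := by
    rw [← Finset.sum_fiberwise Finset.univ e]
    refine Finset.sum_congr rfl fun k _ => ?_
    rw [Finset.sum_congr rfl (g := fun _ => ζ ^ (k : ℕ))]
    · simp [hα]
    · intro c hc
      rw [← he c, (Finset.mem_filter.mp hc).2]
  have hcard : ∑ k, α k = Fintype.card ι := by
    simp only [hα]
    exact_mod_cast (Finset.card_eq_sum_card_fiberwise (f := e) (s := Finset.univ)
      (t := Finset.univ) (by simp)).symm
  rw [hsum, hζ.sum_eq_zero_iff_forall_eq_int hp]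
  constructor
  · intro h u hu
    obtain ⟨k, rfl⟩ := hex u hu
    rw [hfiber]
    have : ∑ j, α j = p * α k := by
      rw [Finset.sum_congr rfl fun j _ => h j k]
      simp
    have := this.symm.trans hcard
    simp only [hα] at this
    exact_mod_cast this
  · intro h i j
    have key (k : Fin p) : (p : ℤ) * α k = Fintype.card ι := by
      have := h (ζ ^ (k : ℕ)) (by rw [← pow_mul, mul_comm, pow_mul, hζ.pow_eq_one, one_pow])
      rw [hfiber] at this
      simp only [hα]
      exact_mod_cast this
    exact mul_left_cancel₀ (by exact_mod_cast hp.ne_zero) ((key i).trans (key j).symm)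

/-- Lemma 2.3: for `p` prime dividing `n` and `H` an `n × n` complex matrix with
entries `p`-th roots of unity, `H` is a `BH(n,p)` iff `H` is a `GH(n, C_p)` over
the group of `p`-th roots of unity: for distinct rows `i ≠ j` and each `p`-th
root of unity `u`, exactly `n/p` columns `c` satisfy `H i c * conj (H j c) = u`. -/
theorem BH_iff_GH_of_prime (n p : ℕ) (hp : p.Prime) (hdvd : p ∣ n)
    (H : Matrix (Fin n) (Fin n) ℂ) (hroots : ∀ i j, H i j ^ p = 1) :
    H * H.conjTranspose = (n : ℂ) • 1 ↔
      ∀ i j : Fin n, i ≠ j → ∀ u : ℂ, u ^ p = 1 →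
        (Finset.univ.filter fun c => H i c * (starRingEnd ℂ) (H j c) = u).card = n / p := by
  have hmem (i j c : Fin n) : (H i c * (starRingEnd ℂ) (H j c)) ^ p = 1 := by
    rw [mul_pow, ← map_pow, hroots, hroots, map_one, mul_one]
  have hdiag (i c : Fin n) : H i c * (starRingEnd ℂ) (H i c) = 1 := by
    rw [Complex.mul_conj', Complex.norm_eq_one_of_pow_eq_one (hroots i c) hp.ne_zero]
    simp
  have horth : H * H.conjTranspose = (n : ℂ) • 1 ↔
      ∀ i j : Fin n, i ≠ j → ∑ c, H i c * (starRingEnd ℂ) (H j c) = 0 := by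
    rw [← Matrix.ext_iff]
    refine forall₂_congr fun i j => ?_
    rcases eq_or_ne i j with rfl | hij
    · simp [Matrix.mul_apply, hdiag]
    · simp [Matrix.mul_apply, hij]
  rw [horth]
  refine forall₃_congr fun i j _ => ?_
  rw [sum_rootsOfUnity_eq_zero_iff hp (Complex.isPrimitiveRoot_exp p hp.ne_zero) _ (hmem i j)]
  refine forall₂_congr fun u _ => ?_
  rw [Fintype.card_fin, eq_comm (b := n / p), Nat.div_eq_iff_eq_mul_right hp.pos hdvd, eq_comm]
end

section
/- Let K be a finite abelian group, let r be an odd prime dividing |K|, and let n be odd. If a GH(n,K) exists, then every positive integer m not divisible by r that divides the square-free part of n has odd multiplicative order modulo r. -/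
/-- If `x ↦ x ^ k` induces `star` modulo `a`, then `a` divides `x` as soon as it divides
`x * star x`. -/
theorem dvd_of_dvd_mul_star {A : Type*} [CommRing A] [StarRing A] {a : A} {k : ℕ} (hk : 2 ≤ k)
    (h : ∀ x : A, a ∣ x ^ k - star x) {x : A} (hx : a ∣ x * star x) : a ∣ x := by
  have h' : a ∣ star x ^ k - x := by simpa using h (star x)
  have hsq : a ∣ x ^ 2 := by
    have h1 : a ∣ x * star x ^ k := hx.trans (mul_dvd_mul_left x (dvd_pow_self _ (by omega)))
    have h2 : x ^ 2 = x * star x ^ k - x * (star x ^ k - x) := by ring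
    rw [h2]
    exact dvd_sub h1 (h'.mul_left x)
  have hstar : a ∣ star x := (dvd_sub_right (hsq.trans (pow_dvd_pow x hk))).mp (h x)
  exact (dvd_sub_right (hstar.trans (dvd_pow_self _ (by omega)))).mp h'

/-- The subring of `ℂ` generated by the `r`-th roots of unity. -/
abbrev rootsOfUnityRing (r : ℕ) : StarSubalgebra ℤ ℂ :=
  StarAlgebra.adjoin ℤ {z : ℂ | z ^ r = 1}

theorem isIntegral_of_mem_rootsOfUnityRing {r : ℕ} (hr : r ≠ 0) {x : ℂ}
    (hx : x ∈ rootsOfUnityRing r) : IsIntegral ℤ x := by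
  induction hx using StarAlgebra.adjoin_induction with
  | mem z hz => exact IsIntegral.of_pow (Nat.pos_of_ne_zero hr) (hz ▸ isIntegral_one)
  | algebraMap n => exact isIntegral_algebraMap
  | add x y _ _ hx hy => exact hx.add hy
  | mul x y _ _ hx hy => exact hx.mul hy
  | star x _ hx => exact hx.map (starRingEnd ℂ).toIntAlgHom

theorem dvd_pow_sub_star_of_dvd_pow_add_one {r q j : ℕ} (hq : q.Prime) (hj : r ∣ q ^ j + 1)
    (x : rootsOfUnityRing r) : (q : rootsOfUnityRing r) ∣ x ^ q ^ j - star x := by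
  have := Fact.mk hq
  obtain ⟨x, hx⟩ := x
  induction hx using StarAlgebra.adjoin_induction with
  | mem z hz =>
    obtain ⟨t, ht⟩ := hj
    have hz : z ^ r = 1 := hz
    have hr : r ≠ 0 := by rintro rfl; simp at ht
    have hpow : z ^ q ^ j * z = 1 := by rw [← pow_succ, ht, pow_mul, hz, one_pow]
    have hstar : star z * z = 1 := by
      have := Complex.conj_mul' z
      rw [Complex.norm_eq_one_of_pow_eq_one hz hr] at this
      simpa using this
    have hz0 : z ≠ 0 := right_ne_zero_of_mul_eq_one hpow
    refine ⟨0, Subtype.ext ?_⟩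
    simpa [sub_eq_zero] using mul_right_cancel₀ hz0 (hpow.trans hstar.symm)
  | algebraMap n =>
    have h : (q : ℤ) ∣ n ^ q ^ j - n := by
      rw [← ZMod.intCast_zmod_eq_zero_iff_dvd]
      simp [ZMod.pow_card_pow]
    obtain ⟨t, ht⟩ := h
    refine ⟨(t : ℤ), Subtype.ext ?_⟩
    have := congrArg (Int.cast : ℤ → ℂ) ht
    push_cast at this
    simpa using this
  | add x y hx hy hx' hy' =>
    obtain ⟨t, ht⟩ := exists_add_pow_prime_pow_eq hq (⟨x, hx⟩ : rootsOfUnityRing r) ⟨y, hy⟩ j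
    have h : (⟨x + y, add_mem hx hy⟩ : rootsOfUnityRing r) = ⟨x, hx⟩ + ⟨y, hy⟩ := rfl
    rw [h, ht, star_add]
    convert (hx'.add hy').add
      (dvd_mul_right (q : rootsOfUnityRing r) (⟨x, hx⟩ * ⟨y, hy⟩ * t)) using 1
    ring
  | mul x y hx hy hx' hy' =>
    have h : (⟨x * y, mul_mem hx hy⟩ : rootsOfUnityRing r) = ⟨x, hx⟩ * ⟨y, hy⟩ := rfl
    rw [h, star_mul', mul_pow]
    obtain ⟨s, hs⟩ := hx'
    obtain ⟨t, ht⟩ := hy'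
    rw [sub_eq_iff_eq_add] at hs ht
    rw [hs, ht]
    exact ⟨q * s * t + s * star ⟨y, hy⟩ + t * star ⟨x, hx⟩, by ring⟩
  | star x hx hx' =>
    obtain ⟨s, hs⟩ := hx'
    refine ⟨star s, ?_⟩
    have h := congrArg star hs
    rw [star_sub, star_pow, star_mul', star_natCast] at h
    exact h

theorem exists_nat_eq_of_isIntegral_of_mul_eq {z : ℂ} (hz : IsIntegral ℤ z)
    {a b : ℕ} (ha : a ≠ 0) (h : a * z = b) : ∃ k : ℕ, z = k := by
  have hzq : z = algebraMap ℚ ℂ (b / a) := by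
    have : (a : ℂ) ≠ 0 := by exact_mod_cast ha
    simp only [eq_ratCast, Rat.cast_div, Rat.cast_natCast]
    field_simp
    linear_combination h
  rw [hzq, isIntegral_algebraMap_iff (algebraMap ℚ ℂ).injective,
    IsIntegrallyClosed.isIntegral_iff] at hz
  obtain ⟨k, hk⟩ := hz
  have hzk : z = (k : ℂ) := by rw [hzq, ← hk]; simp
  have hk0 : 0 ≤ k := by
    have hab : (a : ℤ) * k = b := by rw [hzk] at h; exact_mod_cast h
    have ha' : (0 : ℤ) < a := by positivity
    exact nonneg_of_mul_nonneg_right (hab ▸ b.cast_nonneg) ha'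
  lift k to ℕ using hk0
  exact ⟨k, by simpa using hzk⟩

/-- The multiplicity of a self-conjugate prime in a norm `x * star x` is even. -/
theorem even_factorization_of_mul_star_eq {r q j : ℕ} (hq : q.Prime) (hj0 : j ≠ 0)
    (hr : r ≠ 0) (hj : r ∣ q ^ j + 1) (N : ℕ) (hN : N ≠ 0) (x : rootsOfUnityRing r)
    (hx : x * star x = N) : Even (N.factorization q) := by
  induction N using Nat.strong_induction_on generalizing x with
  | _ N ih =>
    by_cases hqN : q ∣ N
    · have hk : 2 ≤ q ^ j := hq.two_le.trans (Nat.le_self_pow hj0 q)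
      have hdvd : (q : rootsOfUnityRing r) ∣ x * star x := hx ▸ Nat.cast_dvd_cast hqN
      obtain ⟨y, rfl⟩ := dvd_of_dvd_mul_star hk (dvd_pow_sub_star_of_dvd_pow_add_one hq hj) hdvd
      have hy : ((q ^ 2 : ℕ) : ℂ) * (y * star y : rootsOfUnityRing r) = N := by
        have := congrArg (Subtype.val) hx
        simp only [star_mul', star_natCast, MulMemClass.coe_mul] at this
        simp only [MulMemClass.coe_mul]
        push_cast at this ⊢
        linear_combination this
      obtain ⟨k, hk⟩ := exists_nat_eq_of_isIntegral_of_mul_eq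
        (isIntegral_of_mem_rootsOfUnityRing hr (y * star y).2)
        (pow_ne_zero 2 hq.ne_zero) hy
      have hNk : N = q ^ 2 * k := by rw [hk] at hy; exact_mod_cast hy.symm
      have hk0 : k ≠ 0 := by rintro rfl; simp at hNk; exact hN hNk
      have hlt : k < N := by
        rw [hNk]
        exact (Nat.lt_mul_iff_one_lt_left (Nat.pos_of_ne_zero hk0)).mpr
          (Nat.one_lt_pow two_ne_zero hq.one_lt)
      have hev := ih k hlt hk0 y (Subtype.ext (by simpa using hk))
      rw [hNk, Nat.factorization_mul (pow_ne_zero 2 hq.ne_zero) hk0]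
      simpa [hq.factorization_self, Nat.even_add] using hev
    · simp [Nat.factorization_eq_zero_of_not_dvd hqN]

theorem exists_monoidHom_pow_eq_one {K : Type*} [CommGroup K] [Fintype K] {r : ℕ}
    (hr : r.Prime) (hrK : r ∣ Fintype.card K) :
    ∃ χ : K →* ℂˣ, χ ≠ 1 ∧ ∀ g, χ g ^ r = 1 := by
  have := Fact.mk hr
  have : NeZero (Monoid.exponent K) := ⟨Monoid.exponent_ne_zero_of_finite⟩
  obtain ⟨e⟩ := CommGroup.monoidHom_mulEquiv_of_hasEnoughRootsOfUnity K ℂ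
  obtain ⟨g, hg⟩ := exists_prime_orderOf_dvd_card r hrK
  refine ⟨e.symm g, ?_, fun a => ?_⟩
  · intro h
    have : g = 1 := by simpa using h
    rw [this, orderOf_one] at hg
    exact hr.one_lt.ne hg
  · have h : e.symm g ^ r = 1 := by rw [← map_pow, ← hg, pow_orderOf_eq_one, map_one]
    simpa using DFunLike.congr_fun h a

theorem mul_conjTranspose_eq_of_generalizedHadamard {K : Type*} [CommGroup K] [Fintype K]
    [DecidableEq K] {n l r : ℕ} (hr : r ≠ 0) (H : Matrix (Fin n) (Fin n) K)
    (hH : ∀ i j : Fin n, i ≠ j → ∀ g : K,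
      (Finset.univ.filter fun c => H i c * (H j c)⁻¹ = g).card = l)
    (χ : K →* ℂˣ) (hχ : χ ≠ 1) (hχr : ∀ g, χ g ^ r = 1) :
    (H.map fun g => (χ g : ℂ)) * (H.map fun g => (χ g : ℂ)).conjTranspose =
      (n : ℂ) • (1 : Matrix (Fin n) (Fin n) ℂ) := by
  have hstar (g : K) : star (χ g : ℂ) = χ g⁻¹ := by
    have hpow : (χ g : ℂ) ^ r = 1 := by rw [← Units.val_pow_eq_pow_val, hχr, Units.val_one]
    have h := Complex.mul_conj' (χ g : ℂ)
    rw [Complex.norm_eq_one_of_pow_eq_one hpow hr] at h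
    rw [map_inv, Units.val_inv_eq_inv_val]
    exact eq_inv_of_mul_eq_one_right (by simpa using h)
  ext i j
  have hterm (c : Fin n) : (χ (H i c) : ℂ) * star (χ (H j c) : ℂ) =
      χ (H i c * (H j c)⁻¹) := by rw [hstar, map_mul, Units.val_mul]
  simp only [Matrix.mul_apply, Matrix.map_apply, Matrix.conjTranspose_apply, hterm,
    Matrix.smul_apply, smul_eq_mul]
  by_cases hij : i = j
  · subst hij
    simp
  · rw [Matrix.one_apply_ne hij, mul_zero,
      ← Finset.sum_fiberwise Finset.univ (fun c => H i c * (H j c)⁻¹)]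
    have hfib (g : K) : ∑ c with H i c * (H j c)⁻¹ = g, (χ (H i c * (H j c)⁻¹) : ℂ) =
        l * χ g := by
      rw [Finset.sum_congr rfl (g := fun _ => (χ g : ℂ))
        (fun c hc => by rw [(Finset.mem_filter.mp hc).2]), Finset.sum_const,
        hH i j hij, nsmul_eq_mul]
    simp only [hfib, ← Finset.mul_sum]
    have hne : (Units.coeHom ℂ).comp χ ≠ 1 := fun h => hχ <| by
      ext g
      simpa using DFunLike.congr_fun h g
    have := sum_hom_units_eq_zero _ hne
    simp only [MonoidHom.comp_apply, Units.coeHom_apply] at this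
    rw [this, mul_zero]

theorem exists_mul_star_eq_of_generalizedHadamard {K : Type*} [CommGroup K] [Fintype K]
    [DecidableEq K] {n l r : ℕ} (hr : r.Prime) (hrK : r ∣ Fintype.card K)
    (H : Matrix (Fin n) (Fin n) K)
    (hH : ∀ i j : Fin n, i ≠ j → ∀ g : K,
      (Finset.univ.filter fun c => H i c * (H j c)⁻¹ = g).card = l) :
    ∃ x : rootsOfUnityRing r, x * star x = (n ^ n : ℕ) := by
  obtain ⟨χ, hχ, hχr⟩ := exists_monoidHom_pow_eq_one hr hrK
  have hmem (g : K) : (χ g : ℂ) ∈ rootsOfUnityRing r :=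
    StarAlgebra.subset_adjoin ℤ _
      (show (χ g : ℂ) ^ r = 1 by rw [← Units.val_pow_eq_pow_val, hχr, Units.val_one])
  have h := congrArg Matrix.det
    (mul_conjTranspose_eq_of_generalizedHadamard hr.ne_zero H hH χ hχ hχr)
  have hdet : (H.map fun g => (χ g : ℂ)).det ∈ rootsOfUnityRing r := by
    rw [Matrix.det_apply]
    refine sum_mem fun σ _ => ?_
    rw [Units.smul_def]
    exact zsmul_mem (prod_mem fun i _ => hmem _) _
  refine ⟨⟨_, hdet⟩, Subtype.ext ?_⟩
  rw [Matrix.det_mul, Matrix.det_conjTranspose] at h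
  simpa using h

/-- If the order of `q` modulo a prime `r` is even, then `-1` is a power of `q` modulo `r`. -/
theorem exists_dvd_pow_add_one_of_even_orderOf {r q : ℕ} (hr : r.Prime) (hqr : ¬ r ∣ q)
    (h : Even (orderOf (q : ZMod r))) : ∃ j, j ≠ 0 ∧ r ∣ q ^ j + 1 := by
  have := Fact.mk hr
  have hq0 : (q : ZMod r) ≠ 0 := by rwa [Ne, ZMod.natCast_eq_zero_iff]
  have hpos : 0 < orderOf (q : ZMod r) :=
    orderOf_pos_iff.mpr (isOfFinOrder_iff_pow_eq_one.mpr
      ⟨r - 1, Nat.sub_pos_of_lt hr.one_lt, ZMod.pow_card_sub_one_eq_one hq0⟩)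
  obtain ⟨j, hj⟩ := h
  refine ⟨j, by omega, ?_⟩
  have hsq : ((q : ZMod r) ^ j) * (q : ZMod r) ^ j = 1 := by
    rw [← pow_add, ← hj, pow_orderOf_eq_one]
  rw [← ZMod.natCast_eq_zero_iff]
  push_cast
  rcases mul_self_eq_one_iff.mp hsq with h1 | h1
  · exact absurd (Nat.le_of_dvd (by omega) (orderOf_dvd_of_pow_eq_one h1)) (by omega)
  · rw [h1, neg_add_cancel]

theorem odd_orderOf_natCast_of_forall_prime {r m : ℕ} (hm : m ≠ 0)
    (h : ∀ q, q.Prime → q ∣ m → Odd (orderOf (q : ZMod r))) : Odd (orderOf (m : ZMod r)) := by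
  induction m using Nat.recOnMul with
  | zero => exact absurd rfl hm
  | one => simp
  | prime q hq => exact h q hq dvd_rfl
  | mul a b ha hb =>
    rw [mul_ne_zero_iff] at hm
    have ha := ha hm.1 fun q hq hqa => h q hq (hqa.mul_right b)
    have hb := hb hm.2 fun q hq hqb => h q hq (hqb.mul_left a)
    rw [Nat.cast_mul]
    exact (ha.mul hb).of_dvd_nat (Commute.all _ _).orderOf_mul_dvd_mul_orderOf


/-- Theorem 2.4 (de Launey): Let `K` be a finite abelian group, `r` an odd prime
dividing `|K|`, and `n` odd. If a `GH(n,K)` exists, then every positive integer `m`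
not divisible by `r` dividing the square-free part of `n` has odd multiplicative
order modulo `r`. -/
theorem GH_implies_odd_order_mod_r
    (K : Type*) [CommGroup K] [Fintype K] [DecidableEq K]
    (r n : ℕ) (hr : r.Prime) (hrodd : Odd r) (hrK : r ∣ Fintype.card K)
    (hn : Odd n)
    (H : Matrix (Fin n) (Fin n) K)
    (hGH : ∀ i j : Fin n, i ≠ j → ∀ g : K,
      (Finset.univ.filter fun c => H i c * (H j c)⁻¹ = g).card = n / Fintype.card K)
    (m : ℕ) (hm : 0 < m) (hmr : ¬ r ∣ m)
    (hmsq : m ∣ (n.primeFactors.filter fun q => Odd (n.factorization q)).prod id) :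
    Odd (orderOf (m : ZMod r)) := by
  refine odd_orderOf_natCast_of_forall_prime hm.ne' fun q hq hqm => ?_
  by_contra hodd
  obtain ⟨j, hj0, hj⟩ := exists_dvd_pow_add_one_of_even_orderOf hr
    (fun hrq => hmr (hrq.trans hqm)) (Nat.not_odd_iff_even.mp hodd)
  obtain ⟨x, hx⟩ := exists_mul_star_eq_of_generalizedHadamard hr hrK H hGH
  have heven := even_factorization_of_mul_star_eq hq hj0 hr.ne_zero hj (n ^ n)
    (pow_ne_zero n hn.pos.ne') x hx
  obtain ⟨p, hp, hqp⟩ := (hq.prime.dvd_finsetProd_iff id).mp (hqm.trans hmsq)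
  rw [Finset.mem_filter, Nat.mem_primeFactors] at hp
  obtain rfl : q = p := (Nat.prime_dvd_prime_iff_eq hq hp.1.1).mp hqp
  rw [Nat.factorization_pow, Finsupp.smul_apply, smul_eq_mul] at heven
  exact Nat.not_even_iff_odd.mpr (hn.mul hp.2) heven
end

section
/- Let H₁ and H₂ be equivalent BH(n,k) matrices. Then their expanded designs are permutation equivalent: there exist permutations Σ and Τ of (ℤ/k)×{1,…,n} such that E_{H₂}(x, y) = E_{H₁}(Σ(x), Τ(y)) for all x, y ∈ (ℤ/k)×{1,…,n}. -/
/-- Powers of a `k`-th root of unity turn addition in `ZMod k` into multiplication. -/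
theorem pow_zmod_val_add {M : Type*} [Monoid M] {k : ℕ} [NeZero k] {ζ : M} (h : ζ ^ k = 1)
    (u v : ZMod k) : ζ ^ (u + v).val = ζ ^ u.val * ζ ^ v.val := by
  rw [ZMod.val_add, ← pow_eq_pow_mod _ h, pow_add]

/-- The permutation `(i, r) ↦ (i + a r, σ r)` of `G × ι`. -/
def shiftPerm {G ι : Type*} [AddGroup G] (σ : Equiv.Perm ι) (a : ι → G) :
    Equiv.Perm (G × ι) where
  toFun x := (x.1 + a x.2, σ x.2)
  invFun x := (x.1 - a (σ.symm x.2), σ.symm x.2)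
  left_inv x := by simp
  right_inv x := by simp

/-- Proposition 3.2: if `H₁ ≈ H₂` are equivalent `BH(n,k)`s, then their expanded
designs `E_H((i,r),(j,c)) = ζ_k^{i+j} H(r,c)` are permutation equivalent. -/
theorem expanded_designs_perm_equiv_of_equiv
    (n k : ℕ) (hn : 0 < n) (hk : 0 < k)
    (ζ : ℂ) (hζ : ζ = Complex.exp (2 * Real.pi * Complex.I / k))
    (H₁ H₂ : Matrix (Fin n) (Fin n) ℂ)
    (h₁ : IsBH n k H₁) (h₂ : IsBH n k H₂)
    (hequiv : ∃ (σ τ : Equiv.Perm (Fin n)) (a b : Fin n → ZMod k),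
      ∀ r c, H₂ r c = ζ ^ (a r + b c).val * H₁ (σ r) (τ c)) :
    ∃ S T : Equiv.Perm (ZMod k × Fin n),
      ∀ x y : ZMod k × Fin n,
        ζ ^ (x.1 + y.1).val * H₂ x.2 y.2 =
          ζ ^ ((S x).1 + (T y).1).val * H₁ (S x).2 (T y).2 := by
  obtain ⟨σ, τ, a, b, hab⟩ := hequiv
  have : NeZero k := ⟨hk.ne'⟩
  have hζk : ζ ^ k = 1 := hζ ▸ (Complex.isPrimitiveRoot_exp k hk.ne').pow_eq_one
  refine ⟨shiftPerm σ a, shiftPerm τ b, fun x y => ?_⟩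
  change _ = ζ ^ (x.1 + a x.2 + (y.1 + b y.2)).val * H₁ (σ x.2) (τ y.2)
  rw [hab, ← mul_assoc, ← pow_zmod_val_add hζk, add_add_add_comm]
end

section
/- Let K be a finite abelian group, let G be a finite group of order n with |K| dividing n, and let ψ : G × G → K be a normalized 2-cocycle. Then the matrix H = [ψ(x,y)]_{x,y∈G} is a GH(n,K) if and only if H is row-balanced, i.e., for every x ∈ G with x ≠ 1 and every g ∈ K, the number of y ∈ G with ψ(x,y) = g equals n/|K|. Moreover, in that case H is also column-balanced: for every y ≠ 1 and every g ∈ K, the number of x ∈ G with ψ(x,y) = g equals n/|K|. -/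
open Finset

/-- The sum of `f ∘ a` is determined by the fibre sizes of `a` when these are constant. -/
theorem sum_comp_eq_zero_of_card_fiber_eq {ι K R : Type*} [Fintype ι] [Fintype K] [DecidableEq K]
    [CommRing R] (a : ι → K) (m : ℕ) (ha : ∀ g, #{i | a i = g} = m)
    (f : K → R) (hf : ∑ g, f g = 0) : ∑ i, f (a i) = 0 := by
  rw [← Finset.sum_fiberwise univ a]
  have h (g : K) : ∑ i with a i = g, f (a i) = m * f g := by
    rw [← ha g, ← nsmul_eq_mul, ← Finset.sum_const]
    exact Finset.sum_congr rfl fun i hi => by rw [(Finset.mem_filter.1 hi).2]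
  simp_rw [h, ← Finset.mul_sum, hf, mul_zero]

/-- If any two distinct rows of a square matrix over `K` have balanced quotient, then any
multiplicative map `f` on `K` with vanishing sum also sums to zero on the quotient of any two
distinct columns. -/
theorem sum_col_div_eq_zero_of_row_balanced {ι K R : Type*} [Fintype ι] [DecidableEq ι]
    [CommGroup K] [Fintype K] [DecidableEq K] [CommRing R] [Algebra ℚ R]
    (H : ι → ι → K) (m : ℕ) (hH : ∀ x x', x ≠ x' → ∀ g, #{y | H x y * (H x' y)⁻¹ = g} = m)
    (f : K →* R) (hf : ∑ g, f g = 0) (y y' : ι) (hy : y ≠ y') :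
    ∑ x, f (H x y * (H x y')⁻¹) = 0 := by
  have hι : (Fintype.card ι : ℚ) ≠ 0 := by
    have : Nonempty ι := ⟨y⟩
    exact_mod_cast Fintype.card_ne_zero
  let M : Matrix ι ι R := Matrix.of fun x y => f (H x y)
  let N : Matrix ι ι R := Matrix.of fun y x => f (H x y)⁻¹
  have hMN : M * N = (Fintype.card ι : ℚ) • (1 : Matrix ι ι R) := by
    ext x x'
    simp only [Matrix.mul_apply, M, N, Matrix.of_apply, ← map_mul, Matrix.smul_apply]
    by_cases hx : x = x'
    · subst hx
      simp [Algebra.smul_def]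
    · rw [Matrix.one_apply_ne hx, smul_zero]
      exact sum_comp_eq_zero_of_card_fiber_eq _ m (hH x x' hx) f hf
  have h1 : M * ((Fintype.card ι : ℚ)⁻¹ • N) = 1 := by
    rw [Matrix.mul_smul, hMN, smul_smul, inv_mul_cancel₀ hι, one_smul]
  have h2 := mul_eq_one_comm.1 h1
  rw [Matrix.smul_mul, inv_smul_eq_iff₀ hι] at h2
  have h3 := congrFun (congrFun h2 y') y
  rw [Matrix.smul_apply, Matrix.one_apply_ne hy.symm, smul_zero, Matrix.mul_apply] at h3
  simpa only [M, N, Matrix.of_apply, ← map_mul, mul_comm] using h3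

/-- If every multiplicative map on `K` with vanishing sum into the quotient of `ℚ[K]` by the norm
element sums to zero along `a`, then the fibres of `a` all have the same size. -/
theorem card_fiber_eq_of_sum_eq_zero {ι K : Type*} [Fintype ι] [CommGroup K] [Fintype K]
    [DecidableEq K] (a : ι → K)
    (ha : ∀ f : K →* MonoidAlgebra ℚ K ⧸ Ideal.span {∑ g, MonoidAlgebra.of ℚ K g},
      ∑ g, f g = 0 → ∑ i, f (a i) = 0) (g : K) :
    #{i | a i = g} = Fintype.card ι / Fintype.card K := by
  set I : Ideal (MonoidAlgebra ℚ K) := Ideal.span {∑ g, MonoidAlgebra.of ℚ K g} with hI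
  have h := ha ((Ideal.Quotient.mk I : _ →* _).comp (MonoidAlgebra.of ℚ K)) (by
    simp only [MonoidHom.comp_apply, MonoidHom.coe_coe, ← map_sum]
    exact Ideal.Quotient.eq_zero_iff_mem.2 (Ideal.mem_span_singleton_self _))
  simp only [MonoidHom.comp_apply, MonoidHom.coe_coe, ← map_sum] at h
  obtain ⟨b, hb⟩ := Ideal.mem_span_singleton'.1 (Ideal.Quotient.eq_zero_iff_mem.1 h)
  have hcoeff (g : K) : (#{i | a i = g} : ℚ) = ∑ k, b.coeff k := by
    have h_coeff := congrArg (fun c => c.coeff g) hb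
    simp only [Finset.mul_sum, MonoidAlgebra.of_apply, MonoidAlgebra.coeff_sum,
      Finsupp.finsetSum_apply, MonoidAlgebra.coeff_single, Finsupp.single_apply] at h_coeff
    simp only [MonoidAlgebra.coeff_mul_single_apply, mul_one] at h_coeff
    rw [Finset.sum_boole] at h_coeff
    rw [← h_coeff]
    exact Fintype.sum_equiv ((Equiv.inv K).trans (Equiv.mulLeft g)) _ _ fun k => by simp
  have hconst (g' : K) : #{i | a i = g'} = #{i | a i = g} := by
    exact_mod_cast (hcoeff g').trans (hcoeff g).symm
  have hcard : Fintype.card ι = Fintype.card K * #{i | a i = g} := by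
    rw [← Finset.card_univ, Finset.card_eq_sum_card_fiberwise (f := a) (t := univ) (by simp)]
    simp [hconst]
  rw [hcard, Nat.mul_div_cancel_left _ Fintype.card_pos]

/-- Theorem 5.1: for a normalized 2-cocycle `ψ : G × G → K` with `K` finite
abelian and `|K| ∣ n = |G|`, the cocyclic matrix `H = [ψ(x,y)]` is a `GH(n,K)`
iff it is row-balanced; and in that event it is also column-balanced. -/
theorem cocyclic_GH_iff_row_balanced
    (K : Type*) [CommGroup K] [Fintype K] [DecidableEq K]
    (G : Type*) [Group G] [Fintype G] [DecidableEq G]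
    (n : ℕ) (hn : Fintype.card G = n) (hK : Fintype.card K ∣ n)
    (ψ : G → G → K)
    (hcocycle : ∀ x y z : G, ψ x y * ψ (x * y) z = ψ x (y * z) * ψ y z)
    (hnorm : ∀ x : G, ψ x 1 = 1 ∧ ψ 1 x = 1) :
    ((∀ x x' : G, x ≠ x' → ∀ g : K,
        (Finset.univ.filter fun y => ψ x y * (ψ x' y)⁻¹ = g).card = n / Fintype.card K) ↔
      (∀ x : G, x ≠ 1 → ∀ g : K,
        (Finset.univ.filter fun y => ψ x y = g).card = n / Fintype.card K)) ∧
    ((∀ x x' : G, x ≠ x' → ∀ g : K,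
        (Finset.univ.filter fun y => ψ x y * (ψ x' y)⁻¹ = g).card = n / Fintype.card K) →
      (∀ y : G, y ≠ 1 → ∀ g : K,
        (Finset.univ.filter fun x => ψ x y = g).card = n / Fintype.card K)) := by
  refine ⟨⟨fun h x hx g => ?_, fun h x x' hx g => ?_⟩, fun h y hy g => ?_⟩
  · simpa [(hnorm _).2] using h x 1 hx g
  · have hu : x * x'⁻¹ ≠ 1 := fun h1 => hx (mul_inv_eq_one.1 h1)
    rw [← h _ hu (g * ψ (x * x'⁻¹) x')]
    refine Finset.card_equiv (Equiv.mulLeft x') fun y => ?_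
    have hc := hcocycle (x * x'⁻¹) x' y
    rw [inv_mul_cancel_right] at hc
    simp only [Finset.mem_filter, Finset.mem_univ, true_and, Equiv.coe_mulLeft]
    rw [mul_inv_eq_iff_eq_mul, ← mul_right_inj (ψ (x * x'⁻¹) x'), hc, ← mul_assoc,
      mul_left_inj, mul_comm g]
  · rw [← hn]
    refine card_fiber_eq_of_sum_eq_zero (fun x => ψ x y) (fun f hf => ?_) g
    simpa [(hnorm _).1] using sum_col_div_eq_zero_of_row_balanced ψ _ h f hf y 1 hy
end

section
/- For every n ∈ {6, 15, 18, 24, 30, 33, 42, 45, 51, 54, 60, 66, 69, 72, 78, 87, 90, 96, 99}, there is no BH(n,3) all of whose row sums and column sums are equal to one common constant s ∈ ℂ. In particular, for these n there is no group-developed BH(n,3), i.e., no finite group G of order n and map h : G → ℂ with values cube roots of unity such that [h(x·y)]_{x,y∈G} is a BH(n,3). -/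
/-- A complex cube root of unity is an Eisenstein integer. -/
lemma exists_int_of_pow_three_eq_one {z ω : ℂ} (hω : ω ^ 2 + ω + 1 = 0) (hz : z ^ 3 = 1) :
    ∃ a b : ℤ, z = a + b * ω := by
  have h : (z - 1) * ((z - ω) * (z + 1 + ω)) = 0 := by
    linear_combination hz - (z - 1) * hω
  rcases mul_eq_zero.mp h with h | h
  · exact ⟨1, 0, by push_cast; linear_combination h⟩
  rcases mul_eq_zero.mp h with h | h
  · exact ⟨0, 1, by push_cast; linear_combination h⟩
  · exact ⟨-1, -1, by push_cast; linear_combination h⟩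

/-- If a square matrix of cube roots of unity satisfies `H * Hᴴ = n • 1` and has constant row and
column sums, then `n` is the norm of an Eisenstein integer. -/
lemma exists_eq_eisenstein_norm_of_constant_sum {ι : Type*} [Fintype ι] [DecidableEq ι] [Nonempty ι]
    {n : ℕ} {H : Matrix ι ι ℂ} {s : ℂ} (h3 : ∀ i j, H i j ^ 3 = 1)
    (hH : H * H.conjTranspose = (n : ℂ) • 1)
    (hr : ∀ r, ∑ c, H r c = s) (hc : ∀ c, ∑ r, H r c = s) :
    ∃ a b : ℤ, a ^ 2 - a * b + b ^ 2 = n := by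
  obtain ⟨i⟩ := ‹Nonempty ι›
  have hs : s * star s = n := by
    calc s * star s = ∑ j, (H * H.conjTranspose) i j := by
          simp only [Matrix.mul_apply, Matrix.conjTranspose_apply]
          rw [Finset.sum_comm]
          simp_rw [← Finset.mul_sum, ← star_sum, hc]
          rw [← Finset.sum_mul, hr]
      _ = n := by simp [hH, Matrix.one_apply]
  have h3' : (√3 : ℂ) ^ 2 = 3 := by
    rw [← Complex.ofReal_pow, Real.sq_sqrt (by norm_num)]
    norm_num
  have hω : (-1 / 2 + √3 / 2 * Complex.I : ℂ) ^ 2 + (-1 / 2 + √3 / 2 * Complex.I) + 1 = 0 := by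
    linear_combination (√3 : ℂ) ^ 2 / 4 * Complex.I_sq - h3' / 4
  choose a b hab using fun j => exists_int_of_pow_three_eq_one hω (h3 i j)
  refine ⟨∑ j, a j, ∑ j, b j, ?_⟩
  have hs' : s = ((∑ j, a j : ℤ) : ℂ) + ((∑ j, b j : ℤ) : ℂ) * (-1 / 2 + √3 / 2 * Complex.I) := by
    rw [← hr i, Finset.sum_congr rfl fun j _ => hab j, Finset.sum_add_distrib, ← Finset.sum_mul]
    push_cast
    rfl
  generalize ∑ j, a j = A at hs' ⊢
  generalize ∑ j, b j = B at hs' ⊢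
  have hstar : star s = (A : ℂ) + B * (-1 / 2 - √3 / 2 * Complex.I) := by
    rw [hs']
    simp [sub_eq_add_neg, neg_div]
  rw [hstar, hs'] at hs
  have : ((A ^ 2 - A * B + B ^ 2 : ℤ) : ℂ) = (n : ℤ) := by
    push_cast
    linear_combination hs + (B : ℂ) ^ 2 * (√3 : ℂ) ^ 2 / 4 * Complex.I_sq - (B : ℂ) ^ 2 / 4 * h3'
  exact_mod_cast this

lemma eisenstein_norm_ne {n : ℕ}
    (hn : n ∈ ({6, 15, 18, 24, 30, 33, 42, 45, 51, 54, 60, 66, 69, 72, 78, 87,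
      90, 96, 99} : Finset ℕ)) (a b : ℤ) : a ^ 2 - a * b + b ^ 2 ≠ n := by
  intro h
  have hn' : n ≤ 99 := by
    clear h
    revert n
    decide
  have key : ∀ a ∈ Finset.Icc (-11 : ℤ) 11, ∀ b ∈ Finset.Icc (-11 : ℤ) 11,
      (a ^ 2 - a * b + b ^ 2).toNat ∉ ({6, 15, 18, 24, 30, 33, 42, 45, 51, 54, 60, 66, 69, 72, 78,
        87, 90, 96, 99} : Finset ℕ) := by
    decide +kernel
  have ha : a ∈ Finset.Icc (-11 : ℤ) 11 := by
    rw [Finset.mem_Icc]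
    constructor <;> nlinarith [sq_nonneg (2 * b - a)]
  have hb : b ∈ Finset.Icc (-11 : ℤ) 11 := by
    rw [Finset.mem_Icc]
    constructor <;> nlinarith [sq_nonneg (2 * a - b)]
  exact key a ha b hb (by simpa [h] using hn)


/-- Remark 5.7(i): for the listed orders `n ≤ 100`, there is no `BH(n,3)` with
all row and column sums equal to a common constant; in particular there is no
group-developed `BH(n,3)`. -/
theorem no_constant_sum_BH_n_3
    (n : ℕ)
    (hn : n ∈ ({6, 15, 18, 24, 30, 33, 42, 45, 51, 54, 60, 66, 69, 72, 78, 87,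
      90, 96, 99} : Finset ℕ)) :
    (¬ ∃ (H : Matrix (Fin n) (Fin n) ℂ) (s : ℂ), IsBH n 3 H ∧
        (∀ r, ∑ c, H r c = s) ∧ (∀ c, ∑ r, H r c = s)) ∧
    (∀ (G : Type) [Group G] [Fintype G] [DecidableEq G], Fintype.card G = n →
      ∀ h : G → ℂ, (∀ x, h x ^ 3 = 1) →
        ¬ (Matrix.of (fun x y : G => h (x * y)) *
            (Matrix.of fun x y : G => h (x * y)).conjTranspose = (n : ℂ) • 1)) := by
  have hpos : n ≠ 0 := by
    rintro rfl
    revert hn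
    decide
  constructor
  · rintro ⟨H, s, ⟨h3, hH⟩, hr, hc⟩
    have : NeZero n := ⟨hpos⟩
    obtain ⟨a, b, hab⟩ := exists_eq_eisenstein_norm_of_constant_sum h3 hH hr hc
    exact eisenstein_norm_ne hn a b hab
  · intro G _ _ _ _ h h3 hH
    obtain ⟨a, b, hab⟩ := exists_eq_eisenstein_norm_of_constant_sum (s := ∑ g, h g)
      (fun x y => h3 (x * y)) hH (fun x => Equiv.sum_comp (Equiv.mulLeft x) h)
      (fun y => Equiv.sum_comp (Equiv.mulRight y) h)
    exact eisenstein_norm_ne hn a b hab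
end

section
/- Let p be an odd prime and G a finite group of order n such that p² does not divide n. Let ψ : G × G → ℂ be a normalized 2-cocycle all of whose values are p-th roots of unity, and suppose the matrix [ψ(x,y)]_{x,y∈G} is a BH(n,p). Then ψ is a coboundary: there is a map φ : G → ℂ with φ(1) = 1, all values of φ being p-th roots of unity, and ψ(x,y) = φ(x)⁻¹·φ(y)⁻¹·φ(xy) for all x, y ∈ G. In particular, [ψ(x,y)]_{x,y∈G} is equivalent to the group-developed matrix [φ(x·y)]_{x,y∈G}. -/
open Finset in
/-- A function `f` on a finite group whose products along the orbits of left multiplication by `a`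
are trivial is a multiplicative difference `σ (a * y) / σ y`. -/
theorem exists_mul_left_eq_mul {G A : Type*} [Group G] [Finite G] [CommGroup A] (a : G)
    (f : G → A) (hf : ∀ y, ∏ j ∈ range (orderOf a), f (a ^ j * y) = 1) :
    ∃ σ : G → A, ∀ y, σ (a * y) = f y * σ y := by
  have hper (r : G) :
      Function.Periodic (fun i ↦ ∏ j ∈ range i, f (a ^ j * r)) (orderOf a) := fun i ↦ by
    simp only [prod_range_add, add_comm i, hf, one_mul, pow_add, pow_orderOf_eq_one]
  let rep (y : G) : G :=
    (Quotient.out (Quotient.mk (QuotientGroup.rightRel (Subgroup.zpowers a)) y))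
  have hrep (y : G) : ∃ i : ℕ, a ^ i * rep y = y := by
    have h : y * (rep y)⁻¹ ∈ Subgroup.zpowers a :=
      QuotientGroup.rightRel_apply.1 (Quotient.mk_out (s := QuotientGroup.rightRel _) y)
    obtain ⟨i, hi⟩ := mem_powers_iff_mem_zpowers.2 h
    exact ⟨i, by simp_all⟩
  have hrep_mul (y : G) : rep (a * y) = rep y := by
    refine congrArg Quotient.out (Quotient.sound (QuotientGroup.rightRel_apply.2 ?_))
    simp
  choose i hi using hrep
  refine ⟨fun y ↦ ∏ j ∈ range (i y), f (a ^ j * rep y), fun y ↦ ?_⟩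
  have hmod : i (a * y) ≡ i y + 1 [MOD orderOf a] := by
    rw [← pow_eq_pow_iff_modEq, ← mul_left_inj (rep y), pow_succ', mul_assoc, hi,
      ← hrep_mul y, hi]
  have hS := (hper (rep y)).map_mod_nat (i (a * y))
  rw [hmod, (hper (rep y)).map_mod_nat] at hS
  simp only [hrep_mul]
  rw [← hS, prod_range_succ, hi, mul_comm]

open Finset in
/-- If the restriction of a 2-cocycle to the cyclic subgroup generated by `a` has trivial class,
then its power by the index of that subgroup is a coboundary. -/
theorem cocycle_pow_index_zpowers_eq_coboundary {G A : Type*} [Group G] [Finite G] [CommGroup A]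
    (ψ : G → G → A) (hψ : ∀ x y z, ψ x y * ψ (x * y) z = ψ x (y * z) * ψ y z) (a : G)
    (ha : ∀ y, ∏ j ∈ range (orderOf a), ψ a (a ^ j * y) = 1) :
    ∃ φ : G → A, ∀ x y, φ x * φ y = φ (x * y) * ψ x y ^ (Subgroup.zpowers a).index := by
  classical
  have := Fintype.ofFinite (G ⧸ Subgroup.zpowers a)
  obtain ⟨σ, hσ⟩ := exists_mul_left_eq_mul a (ψ a) ha
  let c (y x : G) : A := ψ y x * σ y / σ (y * x)
  have hc (y x : G) : c (a * y) x = c y x := by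
    have h := hψ a y x
    simp only [c, mul_assoc, hσ]
    rw [div_eq_div_iff_mul_eq_mul]
    calc ψ (a * y) x * (ψ a y * σ y) * σ (y * x)
        = (ψ a y * ψ (a * y) x) * (σ y * σ (y * x)) := by ac_rfl
      _ = ψ y x * σ y * (ψ a (y * x) * σ (y * x)) := by rw [h]; ac_rfl
  have hc_pow (k : ℕ) (y x : G) : c (a ^ k * y) x = c y x := by
    induction k with
    | zero => simp
    | succ k ih => rw [pow_succ', mul_assoc, hc, ih]
  have hc_out (g x : G) : c (g : G ⧸ Subgroup.zpowers a).out⁻¹ x = c g⁻¹ x := by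
    have h := QuotientGroup.eq.1 (QuotientGroup.out_eq' (g : G ⧸ Subgroup.zpowers a))
    obtain ⟨k, hk⟩ := mem_powers_iff_mem_zpowers.2 h
    rw [← hc_pow k g⁻¹]
    simp only at hk
    simp [hk]
  have hc_mul (u x y : G) : c u x * c (u * x) y = c u (x * y) * ψ x y := by
    have h := hψ u x y
    simp only [c, mul_assoc u x y]
    rw [div_mul_div_comm, div_mul_eq_mul_div, div_eq_div_iff_mul_eq_mul]
    calc ψ u x * σ u * (ψ (u * x) y * σ (u * x)) * σ (u * (x * y))
        = (ψ u x * ψ (u * x) y) * (σ u * σ (u * x) * σ (u * (x * y))) := by ac_rfl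
      _ = _ := by rw [h]; ac_rfl
  refine ⟨fun x ↦ ∏ q : G ⧸ Subgroup.zpowers a, c q.out⁻¹ x, fun x y ↦ ?_⟩
  have hshift : ∏ q : G ⧸ Subgroup.zpowers a, c q.out⁻¹ y =
      ∏ q : G ⧸ Subgroup.zpowers a, c (q.out⁻¹ * x) y := by
    rw [← Equiv.prod_comp (MulAction.toPerm x⁻¹)]
    refine prod_congr rfl fun q _ ↦ ?_
    have hq : MulAction.toPerm x⁻¹ q = ((x⁻¹ * q.out : G) : G ⧸ Subgroup.zpowers a) := by
      conv_lhs => rw [← QuotientGroup.out_eq' q]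
      rfl
    rw [hq, hc_out]
    simp
  simp only [hshift, ← prod_mul_distrib, hc_mul]
  rw [prod_mul_distrib, prod_const, card_univ, Subgroup.index, Nat.card_eq_fintype_card]

open Finset in
/-- The product of a 2-cocycle over the row indexed by `a` is the product over any orbit of left
multiplication by `a`, raised to the index of the cyclic subgroup generated by `a`. -/
theorem cocycle_prod_orbit_pow_index {G A : Type*} [Group G] [Fintype G] [CommGroup A]
    (ψ : G → G → A) (hψ : ∀ x y z, ψ x y * ψ (x * y) z = ψ x (y * z) * ψ y z) (a y : G) :
    (∏ j ∈ range (orderOf a), ψ a (a ^ j * y)) ^ (Subgroup.zpowers a).index = ∏ x, ψ a x := by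
  classical
  have hprod (f : G → A) :
      ∏ j ∈ range (orderOf a), f (a ^ j) = ∏ h : Subgroup.zpowers a, f h := by
    rw [← Fin.prod_univ_eq_prod_range (fun j ↦ f (a ^ j))]
    exact Fintype.prod_equiv (finEquivZPowers (isOfFinOrder_of_finite a)) _ _ fun _ ↦ rfl
  have horbit (y : G) : ∏ h : Subgroup.zpowers a, ψ a (h * y) =
      ∏ h : Subgroup.zpowers a, ψ a h := by
    have hshift : ∏ h : Subgroup.zpowers a, ψ (a * h) y = ∏ h : Subgroup.zpowers a, ψ h y :=
      Fintype.prod_equiv (Equiv.mulLeft ⟨a, Subgroup.mem_zpowers a⟩) _ _ fun _ ↦ rfl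
    rw [← mul_left_inj (∏ h : Subgroup.zpowers a, ψ h y), ← prod_mul_distrib]
    conv_rhs => rw [← hshift, ← prod_mul_distrib]
    exact prod_congr rfl fun h _ ↦ (hψ a h y).symm
  have hbij : Function.Bijective
      (fun x : (G ⧸ Subgroup.zpowers a) × Subgroup.zpowers a ↦ (x.2 : G) * x.1.out⁻¹) := by
    have hmk (q : G ⧸ Subgroup.zpowers a) (h : Subgroup.zpowers a) :
        (((h : G) * q.out⁻¹)⁻¹ : G) = q := by
      rw [mul_inv_rev, inv_inv, QuotientGroup.mk_mul_of_mem _ (inv_mem h.2),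
        QuotientGroup.out_eq']
    refine ⟨fun ⟨q, h⟩ ⟨q', h'⟩ heq ↦ ?_, fun g ↦ ?_⟩
    · have hq : q = q' := by
        rw [← hmk q h, ← hmk q' h']
        exact congrArg (fun g : G ↦ ((g⁻¹ : G) : G ⧸ Subgroup.zpowers a)) heq
      subst hq
      simpa using heq
    · have hg := QuotientGroup.eq.1 (QuotientGroup.out_eq' ((g⁻¹ : G) : G ⧸ Subgroup.zpowers a))
      exact ⟨⟨((g⁻¹ : G) : G ⧸ Subgroup.zpowers a), ⟨_, inv_mem hg⟩⟩, by simp⟩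
  rw [hprod fun g ↦ ψ a (g * y), horbit,
    ← Fintype.prod_bijective _ hbij (fun x ↦ ψ a (x.2 * x.1.out⁻¹)) _ fun _ ↦ rfl,
    Fintype.prod_prod_type]
  simp only [horbit]
  rw [prod_const, card_univ, Subgroup.index, Nat.card_eq_fintype_card]

open Finset Polynomial in
/-- In a vanishing sum of `p`-th roots of unity all powers of a primitive root have equal
multiplicity. -/
theorem exists_forall_eq_of_sum_mul_pow_eq_zero {p : ℕ} (hp : p.Prime) {ζ : ℂ}
    (hζ : IsPrimitiveRoot ζ p) (N : ℕ → ℕ) (h : ∑ k ∈ range p, (N k : ℂ) * ζ ^ k = 0) :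
    ∃ c : ℕ, ∀ k < p, N k = c := by
  have := Fact.mk hp
  let P : ℤ[X] := ∑ k ∈ range p, C (N k : ℤ) * X ^ k
  have hcoeff (k : ℕ) (hk : k < p) : P.coeff k = N k := by
    simp [P, coeff_X_pow, hk]
  have hroot : aeval ζ P = 0 := by simpa [P] using h
  have hdvd : cyclotomic p ℤ ∣ P := by
    rw [cyclotomic_eq_minpoly hζ hp.pos]
    exact minpoly.isIntegrallyClosed_dvd (hζ.isIntegral hp.pos) hroot
  have hPdeg : P.natDegree ≤ p - 1 := by
    refine natDegree_sum_le_of_forall_le _ _ fun k hk ↦ ?_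
    have := mem_range.1 hk
    exact (natDegree_C_mul_X_pow_le _ _).trans (by omega)
  obtain ⟨R, hR⟩ := hdvd
  obtain ⟨d, rfl⟩ : ∃ d, R = C d := by
    rcases eq_or_ne R 0 with rfl | hR0
    · exact ⟨0, by simp⟩
    refine ⟨_, eq_C_of_natDegree_eq_zero ?_⟩
    rw [hR, natDegree_mul (cyclotomic_ne_zero p ℤ) hR0, natDegree_cyclotomic,
      Nat.totient_prime hp] at hPdeg
    omega
  have hN (k : ℕ) (hk : k < p) : (N k : ℤ) = d := by
    rw [← hcoeff k hk, hR, cyclotomic_prime, coeff_mul_C]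
    simp [coeff_X_pow, hk]
  refine ⟨N 0, fun k hk ↦ ?_⟩
  exact_mod_cast (hN k hk).trans (hN 0 hp.pos).symm

open Finset in
/-- A vanishing sum of `p`-th roots of unity, `p` an odd prime, has length divisible by `p`, and
the product of its terms is `1`. -/
theorem dvd_card_and_prod_eq_one_of_sum_eq_zero {p : ℕ} (hp : p.Prime) (hodd : Odd p)
    {ι : Type*} [Fintype ι] (f : ι → ℂ) (hf : ∀ i, f i ^ p = 1) (h : ∑ i, f i = 0) :
    p ∣ Fintype.card ι ∧ ∏ i, f i = 1 := by
  classical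
  have hζ := Complex.isPrimitiveRoot_exp p hp.ne_zero
  set ζ := Complex.exp (2 * Real.pi * Complex.I / p)
  have : NeZero p := ⟨hp.ne_zero⟩
  choose e he hfe using fun i ↦ hζ.eq_pow_of_pow_eq_one (hf i)
  have hmem (i : ι) (_ : i ∈ univ) : e i ∈ range p := mem_range.2 (he i)
  have hfib (k : ℕ) : ∀ i ∈ univ.filter (e · = k), f i = ζ ^ k := fun i hi ↦ by
    rw [← hfe, (mem_filter.1 hi).2]
  obtain ⟨c, hc⟩ := exists_forall_eq_of_sum_mul_pow_eq_zero hp hζ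
    (fun k ↦ (univ.filter (e · = k)).card) (by
      rw [← h, ← sum_fiberwise_of_maps_to hmem]
      refine sum_congr rfl fun k _ ↦ ?_
      rw [sum_congr rfl (hfib k), sum_const, nsmul_eq_mul])
  constructor
  · rw [← card_univ, card_eq_sum_card_fiberwise hmem,
      sum_congr rfl fun k hk ↦ hc k (mem_range.1 hk)]
    simp
  · obtain ⟨m, hm⟩ := hodd
    have hpow : ∏ k ∈ range p, ζ ^ k = 1 := by
      have hsum : ∑ k ∈ range p, k = p * m := by
        have := Finset.sum_range_id_mul_two p
        rw [show p - 1 = m * 2 by omega, ← mul_assoc] at this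
        exact Nat.eq_of_mul_eq_mul_right two_pos this
      rw [prod_pow_eq_pow_sum, hsum, pow_mul, hζ.pow_eq_one, one_pow]
    rw [← prod_fiberwise_of_maps_to hmem, ← one_pow c, ← hpow, ← prod_pow]
    refine prod_congr rfl fun k hk ↦ ?_
    rw [prod_congr rfl (hfib k), prod_const, hc k (mem_range.1 hk)]

open Finset in
/-- A 2-cocycle with values in a group of prime exponent `p` is a coboundary if the row indexed by
an element `a` of order `p` has trivial product and `p ^ 2` does not divide the order of
the group. -/
theorem cocycle_eq_coboundary_of_prod_row_eq_one {G A : Type*} [Group G] [Fintype G] [CommGroup A]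
    {p : ℕ} (hp : p.Prime) (hA : ∀ α : A, α ^ p = 1) (hsf : ¬ p ^ 2 ∣ Fintype.card G)
    (ψ : G → G → A) (hψ : ∀ x y z, ψ x y * ψ (x * y) z = ψ x (y * z) * ψ y z)
    {a : G} (ha : orderOf a = p) (hrow : ∏ y, ψ a y = 1) :
    ∃ φ : G → A, ∀ x y, ψ x y = (φ x)⁻¹ * (φ y)⁻¹ * φ (x * y) := by
  set m := (Subgroup.zpowers a).index
  have hcop : m.Coprime p := by
    refine ((Nat.Prime.coprime_iff_not_dvd hp).2 fun hdvd ↦ hsf ?_).symm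
    rw [← Nat.card_eq_fintype_card, ← (Subgroup.zpowers a).card_mul_index, Nat.card_zpowers, ha,
      sq]
    exact mul_dvd_mul_left p hdvd
  have horbit (y : G) : ∏ j ∈ range (orderOf a), ψ a (a ^ j * y) = 1 := by
    have h := cocycle_prod_orbit_pow_index ψ hψ a y
    rw [hrow] at h
    exact (pow_eq_one_iff_of_coprime hcop).1 ⟨h, hA _⟩
  obtain ⟨φ, hφ⟩ := cocycle_pow_index_zpowers_eq_coboundary ψ hψ a horbit
  obtain ⟨k, -, hk⟩ := Nat.exists_mul_mod_eq_one_of_coprime hcop hp.one_lt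
  have hmk (α : A) : (α ^ m) ^ k = α := by
    rw [← pow_mul, ← Nat.div_add_mod (m * k) p, hk, pow_add, pow_mul, hA, one_pow, one_mul,
      pow_one]
  refine ⟨fun x ↦ (φ x ^ k)⁻¹, fun x y ↦ ?_⟩
  rw [inv_inv, inv_inv, ← mul_pow, hφ, mul_pow, hmk, mul_inv_cancel_comm]

/-- Corollary 5.9: if `p` is an odd prime, `|G| = n` is `p`-square-free, and
`ψ` is a normalized 2-cocycle on `G` with values `p`-th roots of unity whose
cocyclic matrix is a `BH(n,p)`, then `ψ` is a coboundary `∂φ`; in particular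
the cocyclic matrix `[ψ(x,y)]` is equivalent to the group-developed matrix
`[φ(xy)]` (multiplying row `x` by `φ(x)` and column `y` by `φ(y)` turns the
entry `ψ(x,y)` into `φ(xy)`). -/
theorem cocyclic_BH_coboundary_of_p_squarefree
    (p : ℕ) (hp : p.Prime) (hodd : Odd p)
    (G : Type*) [Group G] [Fintype G] [DecidableEq G]
    (n : ℕ) (hn : Fintype.card G = n) (hsf : ¬ p ^ 2 ∣ n)
    (ψ : G → G → ℂ)
    (hroots : ∀ x y, ψ x y ^ p = 1)
    (hcocycle : ∀ x y z : G, ψ x y * ψ (x * y) z = ψ x (y * z) * ψ y z)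
    (hnorm : ∀ x : G, ψ x 1 = 1 ∧ ψ 1 x = 1)
    (hBH : Matrix.of ψ * (Matrix.of ψ).conjTranspose = (n : ℂ) • 1) :
    ∃ φ : G → ℂ, φ 1 = 1 ∧ (∀ x, φ x ^ p = 1) ∧
      (∀ x y : G, ψ x y = (φ x)⁻¹ * (φ y)⁻¹ * φ (x * y)) ∧
      (∀ x y : G, φ x * ψ x y * φ y = φ (x * y)) := by
  classical
  subst hn
  have hsum (x : G) (hx : x ≠ 1) : ∑ y, ψ x y = 0 := by
    have h := congrFun (congrFun hBH x) 1
    simpa [Matrix.mul_apply, hnorm, hx] using h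
  obtain ⟨φ, hφp, hφ⟩ : ∃ φ : G → ℂ, (∀ x, φ x ^ p = 1) ∧
      ∀ x y, ψ x y = (φ x)⁻¹ * (φ y)⁻¹ * φ (x * y) := by
    rcases subsingleton_or_nontrivial G with hG | hG
    · exact ⟨1, by simp, fun x y ↦ by simp [Subsingleton.elim y 1, hnorm]⟩
    have := Fact.mk hp
    obtain ⟨g, hg⟩ := exists_ne (1 : G)
    obtain ⟨a, ha⟩ := exists_prime_orderOf_dvd_card p
      (dvd_card_and_prod_eq_one_of_sum_eq_zero hp hodd _ (hroots g) (hsum g hg)).1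
    have ha1 : a ≠ 1 := by
      rintro rfl
      exact hp.one_lt.ne (by simpa using ha)
    have hrow := (dvd_card_and_prod_eq_one_of_sum_eq_zero hp hodd _ (hroots a) (hsum a ha1)).2
    have : NeZero p := ⟨hp.ne_zero⟩
    let coe : rootsOfUnity p ℂ →* ℂ := (Units.coeHom ℂ).comp (rootsOfUnity p ℂ).subtype
    have hcoe : Function.Injective coe := Units.val_injective.comp Subtype.val_injective
    have hcoe_pow (α : rootsOfUnity p ℂ) : α ^ p = 1 := Subtype.ext α.2
    let Ψ (x y : G) : rootsOfUnity p ℂ := rootsOfUnity.mkOfPowEq (ψ x y) (hroots x y)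
    have hΨ (x y : G) : coe (Ψ x y) = ψ x y := rfl
    obtain ⟨φ, hφ⟩ := cocycle_eq_coboundary_of_prod_row_eq_one hp hcoe_pow hsf Ψ
      (fun x y z ↦ hcoe (by simp only [map_mul, hΨ, hcocycle])) ha
      (hcoe (by simp only [map_prod, hΨ, hrow, map_one]))
    refine ⟨fun x ↦ coe (φ x), fun x ↦ by rw [← map_pow, hcoe_pow, map_one], fun x y ↦ ?_⟩
    rw [← hΨ, hφ, map_mul, map_mul]
    simp [coe]
  have hne (x : G) : φ x ≠ 0 := fun h ↦ by simpa [h, hp.ne_zero] using hφp x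
  refine ⟨φ, ?_, hφp, hφ, fun x y ↦ ?_⟩
  · have h := hφ 1 1
    simpa [hnorm, hne] using h.symm
  · have := hne x
    have := hne y
    rw [hφ]
    field_simp
end

section
/- Let p be an odd prime, G a group of order p, and ψ : G × G → ℂ a normalized 2-cocycle all of whose values are p-th roots of unity such that H = [ψ(x,y)]_{x,y∈G} is a BH(p,p). Then H is equivalent to the Fourier matrix of order p: there exist bijections e₁, e₂ : G → ℤ/p and functions a, b : G → ℤ/p such that ψ(x,y) = ζ_p^{a(x) + b(y) + e₁(x)·e₂(y)} for all x, y ∈ G. -/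
section

open Polynomial

theorem sum_eval_eq_neg_coeff {p : ℕ} [Fact p.Prime] {Q : (ZMod p)[X]} (hQ : Q.natDegree < p) :
    ∑ x, Q.eval x = -Q.coeff (p - 1) := by
  have hp := (Fact.out : p.Prime).two_le
  simp_rw [eval_eq_sum_range' hQ]
  rw [Finset.sum_comm, Finset.sum_eq_single (p - 1)]
  · rw [← Finset.mul_sum]
    have h : ∑ x : ZMod p, x ^ (p - 1) = -1 := by
      have h1 : ∀ x : ZMod p, x ^ (p - 1) = 1 - if x = 0 then 1 else 0 := by
        intro x
        split_ifs with hx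
        · rw [hx, zero_pow (by omega), sub_self]
        · rw [ZMod.pow_card_sub_one_eq_one hx, sub_zero]
      simp [h1]
    rw [h, mul_neg_one]
  · intro i hi hne
    rw [← Finset.mul_sum, FiniteField.sum_pow_lt_card_sub_one, mul_zero]
    rw [Finset.mem_range] at hi
    rw [ZMod.card]
    omega
  · intro h
    exact absurd (Finset.mem_range.2 (by omega)) h

theorem choose_ne_zero_of_lt {p : ℕ} [Fact p.Prime] {k j : ℕ} (hk : k < p) (hj : j ≤ k) :
    (k.choose j : ZMod p) ≠ 0 := by
  rw [Ne, ZMod.natCast_eq_zero_iff]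
  intro h
  have := (Nat.choose_pos hj)
  exact absurd ((Nat.Prime.dvd_factorial Fact.out).1
    (h.trans (by rw [← Nat.choose_mul_factorial_mul_factorial hj, mul_assoc]; exact dvd_mul_right _ _)))
    (by omega)

/-- A function is planar if all its nontrivial difference functions are bijective. -/
def IsPlanar {p : ℕ} (F : ZMod p → ZMod p) : Prop :=
  ∀ a ≠ 0, Function.Bijective fun x => F (x + a) - F x

theorem IsPlanar.add_mul {p : ℕ} {F : ZMod p → ZMod p} (hF : IsPlanar F) (c : ZMod p) :
    IsPlanar fun x => F x + x * c := by
  intro a ha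
  convert (Equiv.addRight (a * c)).bijective.comp (hF a ha) using 1
  funext x
  simp only [Function.comp, Equiv.coe_addRight]
  ring

theorem IsPlanar.sum_sub_pow {p : ℕ} [Fact p.Prime] {F : ZMod p → ZMod p} (hF : IsPlanar F)
    {k : ℕ} (hk : k ≠ 0) :
    ∑ x, ∑ y, (F x - F y) ^ k = -∑ v : ZMod p, v ^ k := by
  rw [Finset.sum_comm]
  have h1 : ∀ y, ∑ x, (F x - F y) ^ k = ∑ a, (F (y + a) - F y) ^ k := fun y =>
    (Equiv.sum_comp (Equiv.addLeft y) fun x => (F x - F y) ^ k).symm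
  rw [Finset.sum_congr rfl fun y _ => h1 y, Finset.sum_comm]
  have h2 : ∀ a, ∑ y, (F (y + a) - F y) ^ k =
      ∑ v : ZMod p, v ^ k - if a = 0 then ∑ v : ZMod p, v ^ k else 0 := by
    intro a
    split_ifs with ha
    · simp [ha, hk]
    · rw [sub_zero]
      exact (hF a ha).sum_comp fun v => v ^ k
  simp [h2]

theorem sum_sub_pow_eq {p : ℕ} [NeZero p] (F : ZMod p → ZMod p) (k : ℕ) :
    ∑ x, ∑ y, (F x - F y) ^ k = ∑ m ∈ Finset.range (k + 1),
      (-1) ^ (m + k) * (∑ x, F x ^ m) * (∑ y, F y ^ (k - m)) * (k.choose m) := by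
  simp_rw [sub_pow]
  rw [Finset.sum_congr rfl fun x _ => Finset.sum_comm, Finset.sum_comm]
  refine Finset.sum_congr rfl fun m _ => ?_
  simp only [Finset.mul_sum, Finset.sum_mul]
  exact Finset.sum_comm

theorem sum_sub_pow_two_mul {p : ℕ} [Fact p.Prime] (F : ZMod p → ZMod p) {j : ℕ}
    (hj : ∀ i < j, ∑ x, F x ^ i = 0) :
    ∑ x, ∑ y, (F x - F y) ^ (2 * j) =
      (-1) ^ j * ((2 * j).choose j) * (∑ x, F x ^ j) ^ 2 := by
  rw [sum_sub_pow_eq, Finset.sum_eq_single j]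
  · rw [show 2 * j - j = j by omega, show j + 2 * j = j + j * 2 by ring, pow_add, pow_mul' _ j 2]
    simp
    ring
  · intro m hm hne
    rw [Finset.mem_range] at hm
    rcases lt_or_gt_of_ne hne with h | h
    · simp [hj m h]
    · simp [hj (2 * j - m) (by omega)]
  · intro h
    exact absurd (Finset.mem_range.2 (by omega)) h

theorem IsPlanar.sum_pow_eq_zero {p : ℕ} [Fact p.Prime] {F : ZMod p → ZMod p} (hF : IsPlanar F)
    {j : ℕ} (hj : 2 * j < p - 1) : ∑ x, F x ^ j = 0 := by
  induction j using Nat.strong_induction_on with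
  | _ j ih =>
    rcases Nat.eq_zero_or_pos j with rfl | hpos
    · simp
    have h := sum_sub_pow_two_mul F fun i hi => ih i hi (by omega)
    rw [hF.sum_sub_pow (by omega), FiniteField.sum_pow_lt_card_sub_one _ _ (by rwa [ZMod.card]),
      neg_zero] at h
    have h2 := choose_ne_zero_of_lt (p := p) (k := 2 * j) (j := j) (by omega) (by omega)
    simpa [h2] using h.symm

/-- The polynomial in `c` whose values are the power sums of `F x + x * c`. -/
noncomputable def powerSumPoly {p : ℕ} [NeZero p] (F : ZMod p → ZMod p) (k : ℕ) : (ZMod p)[X] :=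
  ∑ x, (C (F x) + C x * X) ^ k

theorem eval_powerSumPoly {p : ℕ} [NeZero p] (F : ZMod p → ZMod p) (k : ℕ) (c : ZMod p) :
    (powerSumPoly F k).eval c = ∑ x, (F x + x * c) ^ k := by
  simp [powerSumPoly, eval_finsetSum]

theorem natDegree_powerSumPoly_le {p : ℕ} [NeZero p] (F : ZMod p → ZMod p) (k : ℕ) :
    (powerSumPoly F k).natDegree ≤ k := by
  refine natDegree_sum_le_of_forall_le _ _ fun x _ => ?_
  compute_degree

theorem coeff_powerSumPoly {p : ℕ} [NeZero p] (F : ZMod p → ZMod p) (i j : ℕ) :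
    (powerSumPoly F (i + j)).coeff j = (∑ x, F x ^ i * x ^ j) * ((i + j).choose j) := by
  rw [powerSumPoly, finsetSum_coeff, Finset.sum_mul]
  refine Finset.sum_congr rfl fun x _ => ?_
  rw [add_comm (C (F x)), add_pow, finsetSum_coeff, Finset.sum_eq_single j]
  · rw [mul_pow, ← C_pow, ← C_pow, Nat.add_sub_cancel, ← C_eq_natCast, coeff_mul_C, coeff_mul_C,
      coeff_C_mul, coeff_X_pow_self]
    ring
  · intro m _ hm
    rw [mul_pow, ← C_pow, ← C_pow, ← C_eq_natCast, coeff_mul_C, coeff_mul_C,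
      coeff_C_mul, coeff_X_pow, if_neg hm.symm]
    ring
  · intro h
    exact absurd (Finset.mem_range.2 (by omega)) h

theorem eq_zero_of_forall_eval {p : ℕ} [Fact p.Prime] {P : (ZMod p)[X]} (hP : P.natDegree < p)
    (h : ∀ c, P.eval c = 0) : P = 0 :=
  eq_zero_of_natDegree_lt_card_of_eval_eq_zero P (f := id) Function.injective_id h
    (by rwa [ZMod.card])

theorem IsPlanar.moment_eq_zero {p : ℕ} [Fact p.Prime] {F : ZMod p → ZMod p} (hF : IsPlanar F)
    {i j : ℕ} (hij : 2 * (i + j) ≤ p - 1) (hj : 2 * (i + j) = p - 1 → j ≠ 0) :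
    ∑ x, F x ^ i * x ^ j = 0 := by
  have hp := (Fact.out : p.Prime).two_le
  have hcoeff : (powerSumPoly F (i + j)).coeff j = 0 := by
    have hdeg := natDegree_powerSumPoly_le F (i + j)
    rcases hij.lt_or_eq with hlt | heq
    · have : powerSumPoly F (i + j) = 0 := by
        refine eq_zero_of_forall_eval (by omega) fun c => ?_
        rw [eval_powerSumPoly]
        exact (hF.add_mul c).sum_pow_eq_zero hlt
      rw [this, coeff_zero]
    · have hch := choose_ne_zero_of_lt (p := p) (k := 2 * (i + j)) (j := i + j)
        (by omega) (by omega)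
      set u : ZMod p := (-1) ^ (i + j) * ((2 * (i + j)).choose (i + j)) with hu
      have hu0 : u ≠ 0 := mul_ne_zero (pow_ne_zero _ (neg_ne_zero.2 one_ne_zero)) hch
      set w : ZMod p := -∑ v : ZMod p, v ^ (2 * (i + j)) with hw
      have hsq : C u * powerSumPoly F (i + j) ^ 2 - C w = 0 := by
        refine eq_zero_of_forall_eval ?_ fun c => ?_
        · have h1 : (powerSumPoly F (i + j) ^ 2).natDegree ≤ 2 * (i + j) :=
            natDegree_pow_le.trans (by omega)
          have h2 := natDegree_C_mul_le u (powerSumPoly F (i + j) ^ 2)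
          rw [natDegree_sub_C]
          omega
        · have hc := hF.add_mul c
          have h := sum_sub_pow_two_mul (fun x => F x + x * c) (j := i + j)
            fun l hl => hc.sum_pow_eq_zero (by omega)
          rw [hc.sum_sub_pow (by specialize hj heq; omega)] at h
          rw [eval_sub, eval_mul, eval_pow, eval_C, eval_C, eval_powerSumPoly, hu, hw, h, sub_self]
      have h3 := congrArg natDegree (sub_eq_zero.1 hsq)
      rw [natDegree_C_mul hu0, natDegree_pow, natDegree_C] at h3
      exact coeff_eq_zero_of_natDegree_lt (by specialize hj heq; omega)
  rw [coeff_powerSumPoly] at hcoeff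
  exact (mul_eq_zero.1 hcoeff).resolve_right (choose_ne_zero_of_lt (by omega) (by omega))

theorem IsPlanar.natDegree_le_two {p : ℕ} [Fact p.Prime] {Q : (ZMod p)[X]}
    (hQ : Q.natDegree < p) (hF : IsPlanar fun x => Q.eval x) : Q.natDegree ≤ 2 := by
  by_contra! hd
  set d := Q.natDegree with hd_def
  have hdiv := Nat.div_add_mod (p - 1) d
  have hr := Nat.mod_lt (p - 1) (show d > 0 by omega)
  have hm := Nat.div_pos (show d ≤ p - 1 by omega) (by omega)
  set m := (p - 1) / d
  set r := (p - 1) % d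
  obtain ⟨e, he⟩ : ∃ e, d = e + 3 := ⟨d - 3, by omega⟩
  have hQ0 : Q ≠ 0 := by
    rintro rfl
    simp at hd_def
    omega
  have hr' : r ≤ m * (e + 1) := by
    rcases (show 1 ≤ m from hm).lt_or_eq with h | h
    · nlinarith
    · obtain ⟨l, hl⟩ := (Fact.out : p.Prime).eq_two_or_odd'.resolve_left (by omega)
      rw [← h] at hdiv ⊢
      omega
  have hsum : ∑ x, Q.eval x ^ m * x ^ r = 0 := by
    refine hF.moment_eq_zero ?_ ?_
    · rw [he] at hdiv
      nlinarith
    · rintro h h0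
      rw [he] at hdiv
      nlinarith
  have hnd : (Q ^ m * X ^ r).natDegree = p - 1 := by
    rw [natDegree_mul_X_pow _ (pow_ne_zero _ hQ0), natDegree_pow, ← hd_def, mul_comm, hdiv]
  have h := sum_eval_eq_neg_coeff (Q := Q ^ m * X ^ r) (by omega)
  simp only [eval_mul, eval_pow, eval_X, hsum] at h
  rw [← hnd, eq_comm, neg_eq_zero] at h
  exact (mul_ne_zero (pow_ne_zero m hQ0) (pow_ne_zero r X_ne_zero)) (leadingCoeff_eq_zero.1 h)

theorem IsPlanar.exists_quadratic {p : ℕ} [Fact p.Prime] {F : ZMod p → ZMod p}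
    (hF : IsPlanar F) : ∃ a b c : ZMod p, ∀ x, F x = a * x ^ 2 + b * x + c := by
  set Q := Lagrange.interpolate Finset.univ id F with hQ
  have hinj : Set.InjOn (id : ZMod p → ZMod p) (Finset.univ : Finset (ZMod p)) :=
    Function.injective_id.injOn
  have heval : ∀ x, Q.eval x = F x := fun x =>
    Lagrange.eval_interpolate_at_node F hinj (Finset.mem_univ x)
  have hdeg : Q.natDegree < p := by
    have h := Lagrange.degree_interpolate_lt F hinj
    rw [Finset.card_univ, ZMod.card] at h
    rcases eq_or_ne Q 0 with h0 | h0
    · rw [h0, natDegree_zero]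
      exact (Fact.out : p.Prime).pos
    · exact (natDegree_lt_iff_degree_lt h0).2 h
  have h2 : Q.natDegree ≤ 2 := IsPlanar.natDegree_le_two hdeg (by simpa only [heval] using hF)
  refine ⟨Q.coeff 2, Q.coeff 1, Q.coeff 0, fun x => ?_⟩
  rw [← heval, eval_eq_sum_range' (Nat.lt_succ_of_le h2)]
  simp [Finset.sum_range_succ]
  ring

theorem ZMod.sum_univ_of_odd {p : ℕ} [NeZero p] (hp : Odd p) : ∑ x : ZMod p, x = 0 := by
  have h : ∑ x : ZMod p, x = ∑ x : ZMod p, -x := (Equiv.sum_comp (Equiv.neg (ZMod p)) _).symm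
  rw [Finset.sum_neg_distrib] at h
  exact (ZMod.add_self_eq_zero_iff_eq_zero hp).1 (add_eq_zero_iff_eq_neg.2 h)

/-- A function on `ZMod p` with zero sum is the increment of some function. -/
theorem ZMod.exists_sub_eq_of_sum_eq_zero {p : ℕ} [NeZero p] {g : ZMod p → ZMod p}
    (hg : ∑ x, g x = 0) : ∃ F : ZMod p → ZMod p, F 0 = 0 ∧ ∀ x, F (x + 1) = F x + g x := by
  have hsum : ∑ i ∈ Finset.range p, g i = 0 := by
    rw [← hg]
    refine Finset.sum_bij' (fun i _ => (i : ZMod p)) (fun x _ => x.val) ?_ ?_ ?_ ?_ ?_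
    · simp
    · simp [ZMod.val_lt]
    · intro i hi
      exact ZMod.val_cast_of_lt (Finset.mem_range.1 hi)
    · simp
    · simp
  refine ⟨fun x => ∑ i ∈ Finset.range x.val, g i, by simp, fun x => ?_⟩
  have hx := ZMod.val_lt x
  rw [show g x = g (x.val : ℕ) by simp, ← Finset.sum_range_succ]
  rcases (show x.val + 1 ≤ p from hx).lt_or_eq with h | h
  · have : (x + 1).val = x.val + 1 := by
      rw [← ZMod.val_cast_of_lt h]
      simp
    simp only [this]
  · have : x + 1 = 0 := by
      have h' := congrArg (Nat.cast : ℕ → ZMod p) h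
      simpa using h'
    rw [h, hsum]
    simp [this]

theorem ZMod.induction_add_one {p : ℕ} [NeZero p] {P : ZMod p → Prop} (h0 : P 0)
    (h1 : ∀ x, P x → P (x + 1)) (x : ZMod p) : P x := by
  have h : ∀ n : ℕ, P n := fun n => by
    induction n with
    | zero => simpa using h0
    | succ n ih => simpa using h1 _ ih
  simpa using h x.val

/-- An additive normalized cocycle on `ZMod p` whose nontrivial rows are bijective is a nonzero
multiple of the multiplication map. -/
theorem exists_eq_mul_of_cocycle {p : ℕ} [Fact p.Prime] (hodd : Odd p)
    {f : ZMod p → ZMod p → ZMod p}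
    (hf : ∀ x y z, f x y + f (x + y) z = f x (y + z) + f y z)
    (hl : ∀ x, f 0 x = 0) (hr : ∀ x, f x 0 = 0)
    (hbij : ∀ x ≠ 0, Function.Bijective (f x)) :
    ∃ u ≠ 0, ∀ x y, f x y = u * x * y := by
  have hstep : ∀ x y, f x (y + 1) = f x y + (f (x + y) 1 - f y 1) := fun x y => by
    linear_combination -hf x y 1
  have hsymm : ∀ y, f 1 y = f y 1 := by
    refine ZMod.induction_add_one (by rw [hl, hr]) fun y hy => ?_
    rw [hstep, hy, add_comm 1 y]
    ring
  have hsum : ∑ x, f x 1 = 0 := by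
    simp_rw [← hsymm]
    rw [(hbij 1 one_ne_zero).sum_comp fun v => v, ZMod.sum_univ_of_odd hodd]
  obtain ⟨F, hF0, hF⟩ := ZMod.exists_sub_eq_of_sum_eq_zero hsum
  have hcob : ∀ x y, f x y = F (x + y) - F x - F y := by
    intro x
    refine ZMod.induction_add_one (by simp [hr, hF0]) fun y hy => ?_
    rw [hstep, hy, ← add_assoc, hF, hF]
    ring
  have hplanar : IsPlanar F := by
    intro a ha
    convert (Equiv.addRight (F a)).bijective.comp (hbij a ha) using 1
    funext x
    simp only [Function.comp, Equiv.coe_addRight, hcob, add_comm x a]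
    ring
  obtain ⟨a, b, c, habc⟩ := hplanar.exists_quadratic
  have hc : c = 0 := by simpa [hF0, eq_comm] using habc 0
  have hmul : ∀ x y, f x y = 2 * a * x * y := fun x y => by
    rw [hcob, habc, habc, habc, hc]
    ring
  refine ⟨2 * a, fun h => ?_, hmul⟩
  have h01 : f 1 0 = f 1 1 := by rw [hmul, hmul, h, zero_mul, zero_mul, zero_mul]
  exact zero_ne_one ((hbij 1 one_ne_zero).1 h01)

/-- If a sum of `p` many `p`-th roots of unity vanishes, each root occurs exactly once. -/
theorem bijective_of_sum_pow_eq_zero {p : ℕ} [Fact p.Prime] {ζ : ℂ} (hζ : IsPrimitiveRoot ζ p)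
    {g : ZMod p → ZMod p} (h : ∑ x, ζ ^ (g x).val = 0) : Function.Bijective g := by
  classical
  let N : ZMod p → ℤ := fun v => (Finset.univ.filter fun x => g x = v).card
  have hN : ∑ v, N v * ζ ^ v.val = 0 := by
    rw [← h, ← Finset.sum_fiberwise Finset.univ g fun x => ζ ^ (g x).val]
    refine Finset.sum_congr rfl fun v _ => ?_
    have hv : ∀ x ∈ Finset.univ.filter (fun x => g x = v), ζ ^ (g x).val = ζ ^ v.val := by
      simp +contextual
    rw [Finset.sum_congr rfl hv]
    simp [N]
  have hfin : ∑ i : Fin p, ((N (ZMod.finEquiv p i) : ℤ) : ℂ) * ζ ^ i.val = 0 := by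
    rw [← hN, ← Equiv.sum_comp (ZMod.finEquiv p).toEquiv]
    refine Finset.sum_congr rfl fun i _ => ?_
    obtain ⟨n, rfl⟩ : ∃ n, p = n + 1 := ⟨p - 1, by have := i.2; omega⟩
    rfl
  have heq := (hζ.sum_eq_zero_iff_forall_eq_int Fact.out _).1 hfin
  have hsurj : Function.Surjective g := by
    intro v
    by_contra! hv
    have hv0 : N v = 0 := by simp [N, hv]
    have h1 : N (g 0) = N v := by
      simpa using heq ((ZMod.finEquiv p).symm (g 0)) ((ZMod.finEquiv p).symm v)
    rw [hv0] at h1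
    simp only [N, Nat.cast_eq_zero, Finset.card_eq_zero] at h1
    exact Finset.notMem_empty (0 : ZMod p) (h1 ▸ by simp)
  exact Finite.surjective_iff_bijective.1 hsurj

theorem IsPrimitiveRoot.pow_val_add {p : ℕ} [NeZero p] {ζ : ℂ} (hζ : IsPrimitiveRoot ζ p)
    (a b : ZMod p) : ζ ^ (a + b).val = ζ ^ a.val * ζ ^ b.val := by
  rw [← pow_add, ZMod.val_add, ← pow_mod_orderOf ζ (a.val + b.val), ← hζ.eq_orderOf]

theorem IsPrimitiveRoot.pow_val_injective {p : ℕ} [NeZero p] {ζ : ℂ} (hζ : IsPrimitiveRoot ζ p) :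
    Function.Injective fun a : ZMod p => ζ ^ a.val := fun a b h =>
  ZMod.val_injective p (hζ.pow_inj (ZMod.val_lt a) (ZMod.val_lt b) h)

end

/-- Corollary 5.10: a cocyclic `BH(p,p)` (with `p` an odd prime) is equivalent
to the Fourier matrix of order `p`: there are bijections `e₁ e₂ : G ≃ ℤ/p` and
maps `a b : G → ℤ/p` with `ψ(x,y) = ζ_p^{a(x) + b(y) + e₁(x)·e₂(y)}`. -/
theorem cocyclic_BH_p_p_is_Fourier
    (p : ℕ) (hp : p.Prime) (hodd : Odd p) [NeZero p]
    (ζ : ℂ) (hζ : ζ = Complex.exp (2 * Real.pi * Complex.I / p))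
    (G : Type*) [Group G] [Fintype G] [DecidableEq G]
    (hG : Fintype.card G = p)
    (ψ : G → G → ℂ)
    (hroots : ∀ x y, ψ x y ^ p = 1)
    (hcocycle : ∀ x y z : G, ψ x y * ψ (x * y) z = ψ x (y * z) * ψ y z)
    (hnorm : ∀ x : G, ψ x 1 = 1 ∧ ψ 1 x = 1)
    (hBH : Matrix.of ψ * (Matrix.of ψ).conjTranspose = (p : ℂ) • 1) :
    ∃ (e₁ e₂ : G ≃ ZMod p) (a b : G → ZMod p),
      ∀ x y : G, ψ x y = ζ ^ (a x + b y + e₁ x * e₂ y).val := by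
  have : Fact p.Prime := ⟨hp⟩
  have hprim : IsPrimitiveRoot ζ p := hζ ▸ Complex.isPrimitiveRoot_exp p hp.ne_zero
  have hcard : Nat.card (Multiplicative (ZMod p)) = p := by simp
  let e : Multiplicative (ZMod p) ≃* G :=
    mulEquivOfPrimeCardEq (p := p) hcard (by rw [Nat.card_eq_fintype_card, hG])
  let ι : ZMod p → G := fun x => e (Multiplicative.ofAdd x)
  have hι_add : ∀ x y, ι (x + y) = ι x * ι y := fun x y => by simp [ι]
  have hι_zero : ι 0 = 1 := by simp [ι]
  let E : ZMod p ≃ G := Multiplicative.ofAdd.trans e.toEquiv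
  have hE : ∀ x, E x = ι x := fun _ => rfl
  have hex : ∀ x y : ZMod p, ∃ v : ZMod p, ζ ^ v.val = ψ (ι x) (ι y) := fun x y => by
    obtain ⟨i, hi, h⟩ := hprim.eq_pow_of_pow_eq_one (hroots (ι x) (ι y))
    exact ⟨i, by rw [ZMod.val_cast_of_lt hi, h]⟩
  choose f hf using hex
  obtain ⟨u, hu, hfu⟩ := exists_eq_mul_of_cocycle hodd (f := f)
    (fun x y z => hprim.pow_val_injective (by
      simp only [hprim.pow_val_add, hf, hι_add, hcocycle]))
    (fun x => hprim.pow_val_injective (by simp [hf, hι_zero, hnorm]))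
    (fun x => hprim.pow_val_injective (by simp [hf, hι_zero, hnorm]))
    (fun x hx => bijective_of_sum_pow_eq_zero hprim (by
      have hne : ι x ≠ 1 := fun h => hx (E.injective (by rw [hE, hE, h, hι_zero]))
      have h := congrFun (congrFun hBH (ι x)) 1
      simp only [Matrix.mul_apply, Matrix.conjTranspose_apply, Matrix.of_apply, (hnorm _).2,
        star_one, mul_one, Matrix.smul_apply, Matrix.one_apply_ne hne, smul_zero] at h
      simp_rw [hf]
      rw [← h]
      exact Equiv.sum_comp E (ψ (ι x))))
  refine ⟨E.symm.trans (Equiv.mulLeft₀ u hu), E.symm, 0, 0, fun x y => ?_⟩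
  obtain ⟨x, rfl⟩ := E.surjective x
  obtain ⟨y, rfl⟩ := E.surjective y
  have h : ζ ^ (f x y).val = ψ (E x) (E y) := hf x y
  rw [← h, hfu]
  simp
end

section
/- Let p be a prime and let H be a circulant BH(p,p): H is indexed by ℤ/p × ℤ/p, there is f : ℤ/p → ℂ with all values p-th roots of unity such that H(x,y) = f(y − x) for all x, y, and H·Hᴴ = p·I. Then H is equivalent to the Fourier matrix of order p: there exist permutations σ, τ of ℤ/p and functions a, b : ℤ/p → ℤ/p such that ζ_p^{a(r)+b(c)}·H(σ(r), τ(c)) = ζ_p^{r·c} for all r, c ∈ ℤ/p. -/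
open Polynomial in
/-- If the sum of `p` powers of a primitive `p`-th root of unity vanishes, the exponents
run through all residues modulo `p`. -/
theorem surjective_of_sum_primitiveRoot_pow_eq_zero {p : ℕ} [Fact p.Prime] {ζ : ℂ}
    (hζ : IsPrimitiveRoot ζ p) (u : ZMod p → ZMod p) (hu : ∑ z, ζ ^ (u z).val = 0) :
    Function.Surjective u := by
  have hp : p.Prime := Fact.out
  set P : ℚ[X] := ∑ z, X ^ (u z).val with hP
  have hdvd : cyclotomic p ℚ ∣ P := by
    rw [cyclotomic_eq_minpoly_rat hζ hp.pos]
    exact minpoly.dvd _ _ (by simp [hP, hu])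
  have heval : P.eval 1 = p := by simp [hP, eval_finsetSum, ZMod.card]
  have hcyc : (cyclotomic p ℚ).eval 1 = p := eval_one_cyclotomic_prime
  have hp0 : (p : ℚ) ≠ 0 := by exact_mod_cast hp.ne_zero
  have hP0 : P ≠ 0 := by
    intro h
    rw [h, eval_zero] at heval
    exact hp0 heval.symm
  have hdeg : P.natDegree ≤ p - 1 := by
    refine natDegree_sum_le_of_forall_le _ _ fun z _ => ?_
    rw [natDegree_X_pow]
    have := ZMod.val_lt (u z)
    omega
  obtain ⟨Q, hQ⟩ := hdvd
  have hQ0 : Q ≠ 0 := by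
    rintro rfl
    exact hP0 (by rw [hQ, mul_zero])
  have hQdeg : Q.natDegree = 0 := by
    rw [hQ, natDegree_mul (cyclotomic_ne_zero p ℚ) hQ0, natDegree_cyclotomic,
      Nat.totient_prime hp] at hdeg
    omega
  obtain ⟨c, rfl⟩ := natDegree_eq_zero.mp hQdeg
  have hc : c = 1 := by
    rw [hQ, eval_mul, hcyc, eval_C] at heval
    exact mul_left_cancel₀ hp0 (by rw [heval, mul_one])
  intro k
  by_contra! hk
  have hcoeff : P.coeff k.val = 0 := by
    rw [hP, finsetSum_coeff]
    refine Finset.sum_eq_zero fun z _ => ?_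
    rw [coeff_X_pow, if_neg]
    exact fun h => hk z (ZMod.val_injective p h).symm
  rw [hQ, hc, C_1, mul_one, cyclotomic_prime, finsetSum_coeff] at hcoeff
  simp [coeff_X_pow, ZMod.val_lt] at hcoeff

/-- A planar function: all its nontrivial differences are permutations. -/
def IsPlanarFunction {G : Type*} [AddGroup G] (g : G → G) : Prop :=
  ∀ d, d ≠ 0 → Function.Bijective fun x => g (x + d) - g x

theorem IsPlanarFunction.add_mul_left {R : Type*} [CommRing R] {g : R → R}
    (hg : IsPlanarFunction g) (b : R) : IsPlanarFunction fun x => g x + b * x := by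
  intro d hd
  have h := (Equiv.addRight (b * d)).bijective.comp (hg d hd)
  convert h using 2 with x
  simp only [Function.comp_apply, Equiv.coe_addRight]
  ring

section PowerSums

variable {p : ℕ} [Fact p.Prime]

theorem ZMod.sum_pow_sub_one : ∑ x : ZMod p, x ^ (p - 1) = -1 := by
  have hp : p.Prime := Fact.out
  have h : ∀ x : ZMod p, x ^ (p - 1) = 1 - if x = 0 then 1 else 0 := by
    intro x
    split_ifs with hx
    · have := hp.two_le
      rw [hx, zero_pow (by omega), sub_self]
    · rw [ZMod.pow_card_sub_one_eq_one hx, sub_zero]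
  simp [h, ZMod.card]

open Polynomial in
theorem ZMod.sum_eval_eq_neg_coeff (P : (ZMod p)[X]) (hP : P.natDegree ≤ p - 1) :
    ∑ x, P.eval x = -P.coeff (p - 1) := by
  simp_rw [eval_eq_sum_range' (Nat.lt_succ_of_le hP)]
  rw [Finset.sum_comm]
  simp_rw [← Finset.mul_sum]
  rw [Finset.sum_range_succ, ZMod.sum_pow_sub_one, Finset.sum_eq_zero, zero_add, mul_neg_one]
  intro i hi
  rw [FiniteField.sum_pow_lt_card_sub_one, mul_zero]
  rw [ZMod.card]
  exact Finset.mem_range.mp hi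

/-- Power sums of all differences of values of a planar function. -/
theorem IsPlanarFunction.sum_sum_sub_pow {h : ZMod p → ZMod p} (hh : IsPlanarFunction h)
    {k : ℕ} (hk : k ≠ 0) :
    ∑ y, ∑ x, (h x - h y) ^ k = -∑ x : ZMod p, x ^ k := by
  have hshift : ∀ y, ∑ x, (h x - h y) ^ k = ∑ d, (h (y + d) - h y) ^ k := fun y =>
    (Equiv.sum_comp (Equiv.addLeft y) fun x => (h x - h y) ^ k).symm
  simp_rw [hshift]
  rw [Finset.sum_comm]
  have hd : ∀ d : ZMod p, ∑ y, (h (y + d) - h y) ^ k =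
      (∑ x : ZMod p, x ^ k) - if d = 0 then ∑ x : ZMod p, x ^ k else 0 := by
    intro d
    split_ifs with hd
    · simp [hd, hk]
    · rw [sub_zero]
      exact (hh d hd).sum_comp fun x => x ^ k
  simp [hd, ZMod.card]

theorem sum_sum_sub_pow_eq {R ι : Type*} [CommRing R] [Fintype ι] (h : ι → R) (k : ℕ) :
    ∑ y, ∑ x, (h x - h y) ^ k = ∑ i ∈ Finset.range (k + 1),
      (-1) ^ (k - i) * k.choose i * (∑ x, h x ^ i) * ∑ y, h y ^ (k - i) := by
  simp_rw [sub_eq_add_neg, add_pow]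
  have h1 : ∀ y, ∑ x, ∑ i ∈ Finset.range (k + 1), h x ^ i * (-h y) ^ (k - i) * (k.choose i : R) =
      ∑ i ∈ Finset.range (k + 1), (-1) ^ (k - i) * k.choose i * (∑ x, h x ^ i) *
        h y ^ (k - i) := by
    intro y
    rw [Finset.sum_comm]
    refine Finset.sum_congr rfl fun i _ => ?_
    rw [Finset.mul_sum, Finset.sum_mul]
    refine Finset.sum_congr rfl fun x _ => ?_
    rw [neg_pow]
    ring
  simp_rw [h1]
  rw [Finset.sum_comm]
  simp_rw [← Finset.mul_sum]

/-- If all the power sums below `m` vanish, the power sum of order `2 * m` of the differences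
is a multiple of the square of the power sum of order `m`. -/
theorem sum_sum_sub_pow_two_mul {R ι : Type*} [CommRing R] [Fintype ι] (h : ι → R) (m : ℕ)
    (hm : ∀ i < m, ∑ x, h x ^ i = 0) :
    ∑ y, ∑ x, (h x - h y) ^ (2 * m) =
      (-1) ^ m * (2 * m).choose m * (∑ x, h x ^ m) ^ 2 := by
  rw [sum_sum_sub_pow_eq, Finset.sum_eq_single m]
  · rw [show 2 * m - m = m by omega]
    ring
  · intro i hi hne
    rw [Finset.mem_range] at hi
    rcases lt_or_gt_of_ne hne with hlt | hgt
    · rw [hm i hlt]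
      ring
    · rw [hm (2 * m - i) (by omega)]
      ring
  · intro hmem
    exact absurd (Finset.mem_range.mpr (by omega)) hmem

theorem ZMod.natCast_choose_ne_zero {n k : ℕ} (hn : n < p) (hk : k ≤ n) :
    ((n.choose k : ℕ) : ZMod p) ≠ 0 := by
  have hp : p.Prime := Fact.out
  rw [Ne, ZMod.natCast_eq_zero_iff]
  intro hdvd
  have h : p ∣ n.factorial := by
    rw [← Nat.choose_mul_factorial_mul_factorial hk, mul_assoc]
    exact hdvd.mul_right _
  exact absurd (hp.dvd_factorial.mp h) (by omega)

theorem IsPlanarFunction.sum_pow_eq_zero {h : ZMod p → ZMod p} (hh : IsPlanarFunction h) (m : ℕ)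
    (hm : 2 * m < p - 1) : ∑ x, h x ^ m = 0 := by
  induction m using Nat.strong_induction_on with
  | _ m ih =>
    rcases Nat.eq_zero_or_pos m with rfl | hpos
    · simp [ZMod.card]
    · have h1 := sum_sum_sub_pow_two_mul h m fun i hi => ih i hi (by omega)
      rw [hh.sum_sum_sub_pow (by omega),
        FiniteField.sum_pow_lt_card_sub_one _ _ (by rwa [ZMod.card]), neg_zero] at h1
      have hc : ((2 * m).choose m : ZMod p) ≠ 0 :=
        ZMod.natCast_choose_ne_zero (by omega) (by omega)
      have h2 : ((-1 : ZMod p)) ^ m ≠ 0 := pow_ne_zero _ (neg_ne_zero.mpr one_ne_zero)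
      exact pow_eq_zero_iff two_ne_zero |>.mp
        ((mul_eq_zero.mp h1.symm).resolve_left (mul_ne_zero h2 hc))

theorem IsPlanarFunction.sum_pow_half_sq {h : ZMod p → ZMod p} (hh : IsPlanarFunction h) {m : ℕ}
    (hm : 2 * m = p - 1) (hm0 : m ≠ 0) :
    (-1) ^ m * ((2 * m).choose m : ZMod p) * (∑ x, h x ^ m) ^ 2 = 1 := by
  rw [← sum_sum_sub_pow_two_mul h m fun i hi => hh.sum_pow_eq_zero i (by omega),
    hh.sum_sum_sub_pow (by omega), hm, ZMod.sum_pow_sub_one, neg_neg]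

open Polynomial in
/-- The polynomial in `b` whose values are the power sums of `g x + b * x`. -/
noncomputable def pencilPowerSum (g : ZMod p → ZMod p) (k : ℕ) : (ZMod p)[X] :=
  ∑ j ∈ Finset.range (k + 1), C ((∑ x, g x ^ (k - j) * x ^ j) * k.choose j) * X ^ j

theorem eval_pencilPowerSum (g : ZMod p → ZMod p) (k : ℕ) (b : ZMod p) :
    (pencilPowerSum g k).eval b = ∑ x, (g x + b * x) ^ k := by
  simp_rw [add_comm (g _), add_pow]
  rw [Finset.sum_comm, pencilPowerSum, Polynomial.eval_finsetSum]
  refine Finset.sum_congr rfl fun j _ => ?_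
  rw [Polynomial.eval_C_mul, Polynomial.eval_X_pow, Finset.sum_mul, Finset.sum_mul]
  refine Finset.sum_congr rfl fun x _ => ?_
  ring

theorem natDegree_pencilPowerSum_le (g : ZMod p → ZMod p) (k : ℕ) :
    (pencilPowerSum g k).natDegree ≤ k := by
  refine Polynomial.natDegree_sum_le_of_forall_le _ _ fun j hj => ?_
  exact (Polynomial.natDegree_C_mul_X_pow_le _ _).trans
    (Nat.lt_succ_iff.mp (Finset.mem_range.mp hj))

theorem coeff_pencilPowerSum (g : ZMod p → ZMod p) {k j : ℕ} (hj : j ≤ k) :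
    (pencilPowerSum g k).coeff j = (∑ x, g x ^ (k - j) * x ^ j) * k.choose j := by
  rw [pencilPowerSum, Polynomial.finsetSum_coeff]
  simp_rw [Polynomial.coeff_C_mul_X_pow]
  rw [Finset.sum_ite_eq, if_pos (Finset.mem_range.mpr (by omega))]

theorem ZMod.polynomial_eq_zero_of_eval_eq_zero (P : Polynomial (ZMod p)) (hP : P.natDegree < p)
    (h : ∀ b, P.eval b = 0) : P = 0 :=
  Polynomial.eq_zero_of_natDegree_lt_card_of_eval_eq_zero P Function.injective_id h
    (by rwa [ZMod.card])

theorem IsPlanarFunction.coeff_pencilPowerSum_eq_zero {g : ZMod p → ZMod p}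
    (hg : IsPlanarFunction g) {k j : ℕ} (hk : 2 * k ≤ p - 1) (hj : 2 * k = p - 1 → j ≠ 0) :
    (pencilPowerSum g k).coeff j = 0 := by
  have hp : p.Prime := Fact.out
  have hp2 := hp.two_le
  have hplanar : ∀ b, IsPlanarFunction fun x => g x + b * x := hg.add_mul_left
  rcases hk.lt_or_eq with hlt | heq
  · rw [ZMod.polynomial_eq_zero_of_eval_eq_zero (pencilPowerSum g k), Polynomial.coeff_zero]
    · have := natDegree_pencilPowerSum_le g k
      omega
    · intro b
      rw [eval_pencilPowerSum]
      exact (hplanar b).sum_pow_eq_zero k hlt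
  · have hj0 := hj heq
    have hdeg := natDegree_pencilPowerSum_le g k
    set F := pencilPowerSum g k with hF
    set c : ZMod p := (-1) ^ k * ((2 * k).choose k : ZMod p) with hc
    have hFF : Polynomial.C c * F ^ 2 - Polynomial.C 1 = 0 := by
      apply ZMod.polynomial_eq_zero_of_eval_eq_zero
      · rw [Polynomial.natDegree_sub_C]
        have h1 := Polynomial.natDegree_C_mul_le c (F ^ 2)
        have h2 := Polynomial.natDegree_pow F 2
        omega
      · intro b
        simp only [Polynomial.eval_sub, Polynomial.eval_mul, Polynomial.eval_pow,
          Polynomial.eval_C]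
        rw [hF, eval_pencilPowerSum, hc,
          (hplanar b).sum_pow_half_sq heq (by omega), sub_self]
    have hunit : IsUnit F := by
      refine IsUnit.of_mul_eq_one (Polynomial.C c * F) ?_
      rw [sub_eq_zero, Polynomial.C_1] at hFF
      rw [← hFF]
      ring
    exact Polynomial.coeff_eq_zero_of_natDegree_lt
      (by rw [Polynomial.natDegree_eq_zero_of_isUnit hunit]; omega)

theorem IsPlanarFunction.sum_pow_mul_pow_eq_zero {g : ZMod p → ZMod p}
    (hg : IsPlanarFunction g) {i j : ℕ} (hk : 2 * (i + j) ≤ p - 1)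
    (hj : 2 * (i + j) = p - 1 → j ≠ 0) : ∑ x, g x ^ i * x ^ j = 0 := by
  have hp : p.Prime := Fact.out
  have hp2 := hp.two_le
  have h := hg.coeff_pencilPowerSum_eq_zero hk hj
  rw [coeff_pencilPowerSum g (Nat.le_add_left j i), Nat.add_sub_cancel] at h
  exact (mul_eq_zero.mp h).resolve_right
    (ZMod.natCast_choose_ne_zero (by omega) (by omega))

theorem IsPlanarFunction.two_lt {g : ZMod p → ZMod p} (hg : IsPlanarFunction g) : 2 < p := by
  have hp : p.Prime := Fact.out
  refine lt_of_le_of_ne hp.two_le ?_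
  rintro rfl
  have h2 : (2 : ZMod 2) = 0 := by exact_mod_cast ZMod.natCast_self 2
  have h1 : (1 : ZMod 2) + 1 = 0 := by rw [one_add_one_eq_two, h2]
  refine (hg 1 one_ne_zero).injective.ne (zero_ne_one' (ZMod 2)) ?_
  simp only [h1, zero_add]
  linear_combination (g 1 - g 0) * h2

/-- A planar function over a prime field is given by a polynomial of degree at most two. -/
theorem IsPlanarFunction.natDegree_le_two {P : Polynomial (ZMod p)}
    (hP : P.natDegree ≤ p - 1) (hg : IsPlanarFunction fun x => P.eval x) :
    P.natDegree ≤ 2 := by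
  have hp : p.Prime := Fact.out
  have hp2 := hg.two_lt
  obtain ⟨m, hm⟩ : ∃ m, p - 1 = 2 * m := by
    obtain ⟨m, hm⟩ := hp.odd_of_ne_two hp2.ne'
    exact ⟨m, by omega⟩
  by_contra! hd
  set d := P.natDegree with hd_def
  obtain ⟨i, r, hir, hr, hi⟩ : ∃ i r, d * i + r = p - 1 ∧ r < d ∧ 1 ≤ i :=
    ⟨(p - 1) / d, (p - 1) % d, Nat.div_add_mod _ _, Nat.mod_lt _ (by omega),
      (Nat.one_le_div_iff (by omega)).mpr hP⟩
  have hle : r + 2 * i ≤ d * i := by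
    rcases hi.eq_or_lt with rfl | hi2
    · omega
    · nlinarith
  have hzero : ∑ x, P.eval x ^ i * x ^ r = 0 := by
    refine hg.sum_pow_mul_pow_eq_zero (by omega) ?_
    rintro h rfl
    nlinarith
  have hdeg : (P ^ i * Polynomial.X ^ r).natDegree ≤ p - 1 := by
    refine Polynomial.natDegree_mul_le.trans ?_
    rw [Polynomial.natDegree_X_pow, Polynomial.natDegree_pow, ← hd_def, ← hir, mul_comm]
  have hsum := ZMod.sum_eval_eq_neg_coeff _ hdeg
  simp only [Polynomial.eval_mul, Polynomial.eval_pow, Polynomial.eval_X] at hsum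
  rw [hzero, ← hir, Polynomial.coeff_mul_X_pow, mul_comm d i, hd_def,
    Polynomial.coeff_pow_mul_natDegree, eq_comm, neg_eq_zero] at hsum
  have hlead := Polynomial.leadingCoeff_eq_zero.mp (pow_eq_zero_iff (by omega) |>.mp hsum)
  rw [hd_def, hlead, Polynomial.natDegree_zero] at hd
  omega

/-- Planar functions over a prime field are quadratic. -/
theorem IsPlanarFunction.exists_quadratic {g : ZMod p → ZMod p} (hg : IsPlanarFunction g) :
    ∃ α β γ : ZMod p, 2 * α ≠ 0 ∧ ∀ x, g x = α * x ^ 2 + β * x + γ := by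
  have hp : p.Prime := Fact.out
  set P := Lagrange.interpolate Finset.univ id g with hP
  have heval : ∀ x, P.eval x = g x := fun x =>
    Lagrange.eval_interpolate_at_node g (Set.injOn_id _) (Finset.mem_univ x)
  have hlt : P.degree < p := by
    have := Lagrange.degree_interpolate_lt (s := Finset.univ) g
      (Set.injOn_id (Set.univ : Set (ZMod p)) |>.mono (Set.subset_univ _))
    rwa [Finset.card_univ, ZMod.card] at this
  have hdeg : P.natDegree ≤ p - 1 := by
    rcases eq_or_ne P 0 with h0 | h0
    · rw [h0, Polynomial.natDegree_zero]
      exact Nat.zero_le _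
    · exact Nat.le_sub_one_of_lt ((Polynomial.natDegree_lt_iff_degree_lt h0).mpr hlt)
  have hPg : (fun x => P.eval x) = g := funext heval
  have h2 := IsPlanarFunction.natDegree_le_two hdeg (hPg ▸ hg)
  have hquad : ∀ x, g x = P.coeff 2 * x ^ 2 + P.coeff 1 * x + P.coeff 0 := by
    intro x
    rw [← heval x, Polynomial.eval_eq_sum_range' (n := 3) (by omega)]
    simp only [Finset.sum_range_succ, Finset.sum_range_zero]
    ring
  refine ⟨P.coeff 2, P.coeff 1, P.coeff 0, ?_, hquad⟩
  intro h0
  refine (hg 1 one_ne_zero).injective.ne (zero_ne_one' (ZMod p)) ?_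
  simp only [hquad]
  linear_combination -h0

end PowerSums

/-- Proposition 5.3: every circulant `BH(p,p)`, say `H(x,y) = f(y - x)` with
values `p`-th roots of unity, is equivalent to the Fourier matrix of order `p`. -/
theorem circulant_BH_p_p_equiv_Fourier
    (p : ℕ) (hp : p.Prime) [NeZero p]
    (ζ : ℂ) (hζ : ζ = Complex.exp (2 * Real.pi * Complex.I / p))
    (f : ZMod p → ℂ) (hroots : ∀ x, f x ^ p = 1)
    (hBH : Matrix.of (fun x y : ZMod p => f (y - x)) *
      (Matrix.of fun x y : ZMod p => f (y - x)).conjTranspose = (p : ℂ) • 1) :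
    ∃ (σ τ : Equiv.Perm (ZMod p)) (a b : ZMod p → ZMod p),
      ∀ r c : ZMod p, ζ ^ (a r + b c).val * f (τ c - σ r) = ζ ^ (r * c).val := by
  have : Fact p.Prime := ⟨hp⟩
  have hprim : IsPrimitiveRoot ζ p := hζ ▸ Complex.isPrimitiveRoot_exp p hp.ne_zero
  let e := AddChar.zmodChar p hprim.pow_eq_one
  have he : ∀ x, ζ ^ x.val = e x := fun x => (AddChar.zmodChar_apply hprim.pow_eq_one x).symm
  have hexp : ∀ x, ∃ y : ZMod p, f x = e y := by
    intro x
    obtain ⟨n, -, hn⟩ := hprim.eq_pow_of_pow_eq_one (hroots x)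
    exact ⟨n, by rw [← hn, AddChar.zmodChar_apply']⟩
  choose g hg using hexp
  have hplanar : IsPlanarFunction g := by
    intro d hd
    refine (Finite.injective_iff_surjective.mpr ?_).bijective_of_finite
    apply surjective_of_sum_primitiveRoot_pow_eq_zero hprim
    have h := congrFun (congrFun hBH (-d)) 0
    rw [Matrix.smul_apply, Matrix.one_apply_ne (neg_ne_zero.mpr hd), smul_zero,
      Matrix.mul_apply] at h
    rw [← h]
    refine Finset.sum_congr rfl fun z _ => ?_
    simp only [Matrix.conjTranspose_apply, Matrix.of_apply, sub_neg_eq_add, sub_zero, hg, he]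
    rw [sub_eq_add_neg, AddChar.map_add_eq_mul, AddChar.map_neg_eq_conj]
    rfl
  obtain ⟨α, β, γ, hα, hquad⟩ := hplanar.exists_quadratic
  refine ⟨Equiv.mulRight₀ (-(2 * α))⁻¹ (inv_ne_zero (neg_ne_zero.mpr hα)), Equiv.refl _,
    fun r => -(α * (r * (-(2 * α))⁻¹) ^ 2 - β * (r * (-(2 * α))⁻¹) + γ),
    fun c => -(α * c ^ 2 + β * c), fun r c => ?_⟩
  rw [hg, he, he, ← AddChar.map_add_eq_mul, hquad]
  congr 1
  rw [Equiv.mulRight₀_apply, Equiv.refl_apply]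
  have hs : (-(2 * α))⁻¹ * -(2 * α) = 1 := inv_mul_cancel₀ (neg_ne_zero.mpr hα)
  generalize (-(2 * α))⁻¹ = s at hs ⊢
  linear_combination r * c * hs
end
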